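/- Up to isomorphism (relabelling, possibly followed by reflection), there are exactly 32 generalized twisted pre-rotation systems on an 8-element set. -/

import Mathlib

/-!
Common definitions for pre-rotation systems of simple drawings of complete graphs.

A cyclic permutation of a finite set `S` is modelled by an `Equiv.Perm` that fixes
everything outside `S` and has all of `S` in one cycle.  The ternary relation
`CycOrd f S b c d` expresses that, traversing the cycle of `f` starting at `b`,
one meets `c` strictly before `d` (within one full period).  For sets with at least
three elements, a cyclic permutation is uniquely determined by this ternary relation,
so equality of induced subconfigurations is expressed via `CycOrd`.
-/

section Defs

variable {α : Type*}

/-- `f` is a cyclic permutation of the finite set `S`: it fixes every point outside `S`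
and all elements of `S` lie on one common cycle of `f`. -/
def IsCyclicPermOn (f : Equiv.Perm α) (S : Finset α) : Prop :=
  (∀ a ∉ S, f a = a) ∧ ∀ a ∈ S, ∀ b ∈ S, ∃ k : ℕ, (⇑f)^[k] a = b

/-- `b, c, d` appear in this cyclic order in the cyclic permutation `f` of the set `S`:
traversing the cycle starting at `b`, one meets `c` strictly before `d`
(both within one full period). -/
def CycOrd (f : Equiv.Perm α) (S : Finset α) (b c d : α) : Prop :=
  ∃ i j : ℕ, 0 < i ∧ i < j ∧ j < S.card ∧ (⇑f)^[i] b = c ∧ (⇑f)^[j] b = d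

/-- A pre-rotation system on the finite vertex set `α`: every vertex `v` is assigned a
cyclic permutation of the remaining vertices. -/
structure PreRotSys (α : Type*) [Fintype α] [DecidableEq α] where
  rot : α → Equiv.Perm α
  cyc : ∀ v, IsCyclicPermOn (rot v) (Finset.univ.erase v)

variable [Fintype α] [DecidableEq α]

/-- `b, c, d` appear in this cyclic (counterclockwise) order in the rotation of `v`. -/
def rotOrd (P : PreRotSys α) (v b c d : α) : Prop :=
  CycOrd (P.rot v) (Finset.univ.erase v) b c d

/-- `P'` is the reflection of `P`: every cyclic permutation is reversed. -/
def IsReflection (P P' : PreRotSys α) : Prop :=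
  ∀ v, P'.rot v = (P.rot v)⁻¹

/-- `P` is Π4°-free: no induced subconfiguration on four elements is (up to relabelling,
possibly followed by reflection) the obstruction Π4° with
π_a=(b,c,d), π_b=(a,c,d), π_c=(a,b,d), π_d=(a,c,b). -/
def Pi4Free (P : PreRotSys α) : Prop :=
  ∀ a b c d : α, a ≠ b → a ≠ c → a ≠ d → b ≠ c → b ≠ d → c ≠ d →
    ¬ (rotOrd P a b c d ∧ rotOrd P b a c d ∧ rotOrd P c a b d ∧ rotOrd P d a c b) ∧
    ¬ (rotOrd P a b d c ∧ rotOrd P b a d c ∧ rotOrd P c a d b ∧ rotOrd P d a b c)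

/-- The disjoint edges `{p, r}` and `{q, s}` cross: the induced subconfiguration on
`{p, q, r, s}` is, possibly after reversing all four cyclic permutations, equal to
π_p=(q,r,s), π_q=(p,r,s), π_r=(p,q,s), π_s=(p,q,r). -/
def Crosses (P : PreRotSys α) (p q r s : α) : Prop :=
  (p ≠ q ∧ p ≠ r ∧ p ≠ s ∧ q ≠ r ∧ q ≠ s ∧ r ≠ s) ∧
  ((rotOrd P p q r s ∧ rotOrd P q p r s ∧ rotOrd P r p q s ∧ rotOrd P s p q r) ∨
   (rotOrd P p q s r ∧ rotOrd P q p s r ∧ rotOrd P r p s q ∧ rotOrd P s p r q))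

/-- Two pre-rotation systems are isomorphic: one is obtained from the other by
relabelling the elements, possibly followed by reflection. -/
def IsoPRS (P P' : PreRotSys α) : Prop :=
  ∃ e : Equiv.Perm α,
    (∀ v, P'.rot (e v) = e * P.rot v * e⁻¹) ∨
    (∀ v, P'.rot (e v) = (e * P.rot v * e⁻¹)⁻¹)

/-- The induced subconfigurations `P|_I` and `P'|_I` are equal (expressed via the
ternary cyclic-order relations, which determine cyclic permutations of sets with
at least three elements). -/
def RestrictEq (P P' : PreRotSys α) (I : Finset α) : Prop :=
  ∀ v ∈ I, ∀ b ∈ I, ∀ c ∈ I, ∀ d ∈ I, (rotOrd P v b c d ↔ rotOrd P' v b c d)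

/-- The induced subconfiguration `P'|_I` is the reflection of `P|_I` (expressed via
the ternary cyclic-order relations). -/
def RestrictReflEq (P P' : PreRotSys α) (I : Finset α) : Prop :=
  ∀ v ∈ I, ∀ b ∈ I, ∀ c ∈ I, ∀ d ∈ I, (rotOrd P' v b c d ↔ rotOrd P v b d c)

/-- The `k` distinct elements `u 0, …, u (k-1)` form a perfect twisted configuration `T_k`:
for all `a < b < c < d`, the disjoint edges `{u a, u d}` and `{u b, u c}` cross, and no
other pair of disjoint edges among them crosses. -/
def TwistedTuple (P : PreRotSys α) {k : ℕ} (u : Fin k → α) : Prop :=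
  ∀ a b c d : Fin k, a < b → b < c → c < d →
    Crosses P (u a) (u b) (u d) (u c) ∧
    ¬ Crosses P (u a) (u c) (u b) (u d) ∧
    ¬ Crosses P (u a) (u b) (u c) (u d)

/-- `P` is generalized twisted: it is Π4°-free and every induced subconfiguration on
five elements is of twisted type (i.e. can be labelled so as to form a `T_5`). -/
def GenTwisted (P : PreRotSys α) : Prop :=
  Pi4Free P ∧
    ∀ w : Fin 5 → α, Function.Injective w →
      ∃ e : Equiv.Perm (Fin 5), TwistedTuple P (fun x => w (e x))

/-- `P` contains `T_k`, the perfect twisted drawing on `k` vertices. -/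
def ContainsT (P : PreRotSys α) (k : ℕ) : Prop :=
  ∃ u : Fin k → α, Function.Injective u ∧ TwistedTuple P u

end Defs

/-! ### Encoding of orientation functions by numbers -/

/-- `(b, c, d)` is an even permutation of its increasing rearrangement. -/
def evenTriple (b c d : ℕ) : Bool := (b.blt c ^^ c.blt d) ^^ b.blt d

/-- The orientation function of the perfect twisted system: the rotation at `v` orders an increasing
triple positively exactly when at most one of its members is smaller than `v`. -/
def twistedOrient (v b c d : ℕ) : Bool :=
  ((b.blt v).toNat + (c.blt v).toNat + (d.blt v).toNat).blt 2 ^^ !evenTriple b c d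

/-! ### Cyclic orders -/

section CyclicOrder

variable {α : Type*} {f : Equiv.Perm α} {S : Finset α}

theorem IsCyclicPermOn.apply_mem (hf : IsCyclicPermOn f S) {a : α} (ha : a ∈ S) : f a ∈ S := by
  by_contra h
  exact h (by simpa [f.injective (hf.1 _ h)] using ha)

theorem IsCyclicPermOn.iterate_mem (hf : IsCyclicPermOn f S) {a : α} (ha : a ∈ S) (k : ℕ) :
    f^[k] a ∈ S := by
  induction k with
  | zero => exact ha
  | succ k ih => rw [Function.iterate_succ_apply']; exact hf.apply_mem ih

theorem IsCyclicPermOn.minimalPeriod_eq (hf : IsCyclicPermOn f S) {b : α} (hb : b ∈ S) :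
    Function.minimalPeriod f b = S.card := by
  classical
  have hper : 0 < Function.minimalPeriod f b := by
    obtain ⟨k, hk⟩ := hf.2 _ (hf.apply_mem hb) b hb
    rw [← Function.iterate_succ_apply] at hk
    exact Function.IsPeriodicPt.minimalPeriod_pos (Nat.succ_pos k) hk
  have himage : S = (Finset.range (Function.minimalPeriod f b)).image fun k => f^[k] b := by
    ext a
    simp only [Finset.mem_image, Finset.mem_range]
    constructor
    · intro ha
      obtain ⟨k, rfl⟩ := hf.2 b hb a ha
      exact ⟨_, Nat.mod_lt k hper, Function.iterate_mod_minimalPeriod_eq⟩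
    · rintro ⟨k, -, rfl⟩
      exact hf.iterate_mem hb k
  conv_rhs => rw [himage]
  rw [Finset.card_image_of_injOn, Finset.card_range]
  exact (Function.iterate_injOn_Iio_minimalPeriod (f := f) (x := b)).mono fun k hk => by
    simpa using hk

theorem IsCyclicPermOn.iterate_card (hf : IsCyclicPermOn f S) {b : α} (hb : b ∈ S) :
    f^[S.card] b = b := by
  rw [← hf.minimalPeriod_eq hb]
  exact Function.iterate_minimalPeriod

theorem IsCyclicPermOn.iterate_inj (hf : IsCyclicPermOn f S) {b : α} (hb : b ∈ S) {i j : ℕ}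
    (hi : i < S.card) (hj : j < S.card) (h : f^[i] b = f^[j] b) : i = j := by
  rw [← hf.minimalPeriod_eq hb] at hi hj
  exact Function.iterate_injOn_Iio_minimalPeriod hi hj h

theorem IsCyclicPermOn.exists_iterate (hf : IsCyclicPermOn f S) {b c : α} (hb : b ∈ S)
    (hc : c ∈ S) : ∃ i < S.card, f^[i] b = c := by
  obtain ⟨k, rfl⟩ := hf.2 b hb c hc
  refine ⟨k % S.card, Nat.mod_lt _ (Finset.card_pos.2 ⟨b, hb⟩), ?_⟩
  rw [← hf.minimalPeriod_eq hb]
  exact Function.iterate_mod_minimalPeriod_eq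

theorem IsCyclicPermOn.inv (hf : IsCyclicPermOn f S) : IsCyclicPermOn f⁻¹ S := by
  refine ⟨fun a ha => by rw [Equiv.Perm.inv_eq_iff_eq, hf.1 a ha], fun a ha b hb => ?_⟩
  obtain ⟨k, hk⟩ := hf.2 b hb a ha
  refine ⟨k, ?_⟩
  rw [← hk]
  exact (Function.LeftInverse.iterate f.symm_apply_apply k) b

theorem CycOrd.rotate (hf : IsCyclicPermOn f S) {b c d : α} (hb : b ∈ S)
    (h : CycOrd f S b c d) : CycOrd f S c d b := by
  obtain ⟨i, j, hi, hij, hj, rfl, rfl⟩ := h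
  refine ⟨j - i, S.card - i, by omega, by omega, by omega, ?_, ?_⟩
  · rw [← Function.iterate_add_apply, Nat.sub_add_cancel hij.le]
  · rw [← Function.iterate_add_apply, Nat.sub_add_cancel (by omega), hf.iterate_card hb]

theorem CycOrd.asymm (hf : IsCyclicPermOn f S) {b c d : α} (hb : b ∈ S)
    (h : CycOrd f S b c d) : ¬ CycOrd f S b d c := by
  rintro ⟨i', j', -, hij', hj', h₁, h₂⟩
  obtain ⟨i, j, -, hij, hj, rfl, rfl⟩ := h
  have := hf.iterate_inj hb (by omega) (by omega) h₁
  have := hf.iterate_inj hb (by omega) (by omega) h₂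
  omega

theorem CycOrd.total (hf : IsCyclicPermOn f S) {b c d : α} (hb : b ∈ S) (hc : c ∈ S)
    (hd : d ∈ S) (hbc : b ≠ c) (hbd : b ≠ d) (hcd : c ≠ d) :
    CycOrd f S b c d ∨ CycOrd f S b d c := by
  obtain ⟨i, hi, rfl⟩ := hf.exists_iterate hb hc
  obtain ⟨j, hj, rfl⟩ := hf.exists_iterate hb hd
  have hi0 : 0 < i := Nat.pos_of_ne_zero (by rintro rfl; exact hbc rfl)
  have hj0 : 0 < j := Nat.pos_of_ne_zero (by rintro rfl; exact hbd rfl)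
  rcases lt_trichotomy i j with h | rfl | h
  · exact Or.inl ⟨i, j, hi0, h, hj, rfl, rfl⟩
  · exact absurd rfl hcd
  · exact Or.inr ⟨j, i, hj0, h, hi, rfl, rfl⟩

theorem CycOrd.trans (hf : IsCyclicPermOn f S) {b c d e : α} (hb : b ∈ S)
    (h : CycOrd f S b c d) (h' : CycOrd f S b d e) : CycOrd f S b c e := by
  obtain ⟨i, j, hi, hij, hj, rfl, rfl⟩ := h
  obtain ⟨i', j', -, hij', hj', h₁, rfl⟩ := h'
  have := hf.iterate_inj hb (by omega) (by omega) h₁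
  exact ⟨i, j', hi, by omega, hj', rfl, rfl⟩

theorem CycOrd.inv (hf : IsCyclicPermOn f S) {b c d : α} (hb : b ∈ S)
    (h : CycOrd f S b c d) : CycOrd f⁻¹ S b d c := by
  obtain ⟨i, j, hi, hij, hj, rfl, rfl⟩ := h
  have key : ∀ k ≤ S.card, (⇑f⁻¹)^[S.card - k] b = f^[k] b := fun k hk => by
    conv_lhs => rw [← hf.iterate_card hb, ← Nat.sub_add_cancel hk, Function.iterate_add_apply,
      Nat.sub_add_cancel hk]
    exact (Function.LeftInverse.iterate f.symm_apply_apply _) _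
  exact ⟨S.card - j, S.card - i, by omega, by omega, by omega, key j hj.le, key i (by omega)⟩

theorem CycOrd.conj {T : Finset α} (hST : S.card = T.card) (e : Equiv.Perm α) {b c d : α}
    (h : CycOrd f S b c d) : CycOrd (e * f * e⁻¹) T (e b) (e c) (e d) := by
  obtain ⟨i, j, hi, hij, hj, rfl, rfl⟩ := h
  have key : ∀ k, (e * f * e⁻¹)^[k] (e b) = e (f^[k] b) := fun k => by
    refine (Function.Semiconj.iterate_right (f := e) (fun x => ?_) k b).symm
    simp
  exact ⟨i, j, hi, hij, hST ▸ hj, key i, key j⟩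

theorem IsCyclicPermOn.eq_of_cycOrd {g : Equiv.Perm α} (hf : IsCyclicPermOn f S)
    (hg : IsCyclicPermOn g S) (hS : 2 < S.card)
    (h : ∀ b ∈ S, ∀ c ∈ S, ∀ d ∈ S, b ≠ c → b ≠ d → c ≠ d → CycOrd f S b c d →
      CycOrd g S b c d) : f = g := by
  have next : ∀ {f : Equiv.Perm α}, IsCyclicPermOn f S → ∀ b ∈ S, b ≠ f b ∧
      ∀ c ∈ S, b ≠ c → c ≠ f b → CycOrd f S b (f b) c := by
    intro f hf b hb
    refine ⟨fun hfb => ?_, fun c hc hbc hcf => ?_⟩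
    · have := hf.iterate_inj hb (i := 0) (j := 1) (by omega) (by omega) hfb
      omega
    · obtain ⟨i, hi, rfl⟩ := hf.exists_iterate hb hc
      refine ⟨1, i, one_pos, ?_, hi, rfl, rfl⟩
      rcases i with - | - | i
      · exact absurd rfl hbc
      · exact absurd rfl hcf
      · omega
  ext b
  by_cases hb : b ∈ S
  · by_contra hne
    have hfb := hf.apply_mem hb
    have hgb := hg.apply_mem hb
    have h₁ := h b hb _ hfb _ hgb (next hf b hb).1 (next hg b hb).1 hne
      ((next hf b hb).2 _ hgb (next hg b hb).1 (Ne.symm hne))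
    exact h₁.asymm hg hb ((next hg b hb).2 _ hfb (next hf b hb).1 hne)
  · rw [hf.1 b hb, hg.1 b hb]

end CyclicOrder

/-! ### Orientation functions -/

/-- `O v b c d` behaves, on distinct members of `s`, like the orientation of `b, c, d` in a cyclic
order around `v`, as far as permutations of `b, c, d` are concerned. -/
structure IsOrientationOn {ι : Type*} (O : ι → ι → ι → ι → Bool) (s : Set ι) : Prop where
  rotate : ∀ v ∈ s, ∀ b ∈ s, ∀ c ∈ s, ∀ d ∈ s, [v, b, c, d].Nodup → O v c d b = O v b c d
  swap : ∀ v ∈ s, ∀ b ∈ s, ∀ c ∈ s, ∀ d ∈ s, [v, b, c, d].Nodup → O v b d c = !O v b c d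

theorem IsOrientationOn.comp {ι κ : Type*} {O : κ → κ → κ → κ → Bool} {t : Set κ}
    (hO : IsOrientationOn O t) {w : ι → κ} {s : Set ι} (hw : Set.InjOn w s)
    (hst : Set.MapsTo w s t) : IsOrientationOn (fun i j k l => O (w i) (w j) (w k) (w l)) s := by
  have key : ∀ v ∈ s, ∀ b ∈ s, ∀ c ∈ s, ∀ d ∈ s, [v, b, c, d].Nodup →
      [w v, w b, w c, w d].Nodup := by
    intro v hv b hb c hc d hd h
    exact List.Nodup.map_on (l := [v, b, c, d]) (fun x hx y hy => hw
      (by simp at hx; aesop) (by simp at hy; aesop)) h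
  exact ⟨fun v hv b hb c hc d hd h => hO.rotate _ (hst hv) _ (hst hb) _ (hst hc) _ (hst hd)
      (key v hv b hb c hc d hd h),
    fun v hv b hb c hc d hd h => hO.swap _ (hst hv) _ (hst hb) _ (hst hc) _ (hst hd)
      (key v hv b hb c hc d hd h)⟩

theorem IsOrientationOn.eq_of_increasing {ι : Type*} [LinearOrder ι]
    {O O' : ι → ι → ι → ι → Bool} {s : Set ι} (hO : IsOrientationOn O s)
    (hO' : IsOrientationOn O' s) {v b c d : ι} (hv : v ∈ s)
    (h : ∀ b ∈ s, ∀ c ∈ s, ∀ d ∈ s, [v, b, c, d].Nodup → b < c → c < d → O v b c d = O' v b c d)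
    (hb : b ∈ s) (hc : c ∈ s) (hd : d ∈ s)
    (hn : [v, b, c, d].Nodup) : O v b c d = O' v b c d := by
  have hsmallest : ∀ b ∈ s, ∀ c ∈ s, ∀ d ∈ s, [v, b, c, d].Nodup → b < c → b < d →
      O v b c d = O' v b c d := by
    intro b hb c hc d hd hn hbc hbd
    rcases lt_or_ge c d with hcd | hdc
    · exact h b hb c hc d hd hn hbc hcd
    · have hn' : [v, b, d, c].Nodup := by simp_all [eq_comm]
      have hdc : d < c := lt_of_le_of_ne hdc (by simp_all [eq_comm])
      rw [hO.swap v hv b hb d hd c hc hn', hO'.swap v hv b hb d hd c hc hn',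
        h b hb d hd c hc hn' hbd hdc]
  have hn₁ : [v, c, d, b].Nodup := by simp_all [eq_comm]
  have hn₂ : [v, d, b, c].Nodup := by simp_all [eq_comm]
  have hne : b ≠ c ∧ b ≠ d ∧ c ≠ d := by simp_all
  by_cases hmin : b < c ∧ b < d
  · exact hsmallest b hb c hc d hd hn hmin.1 hmin.2
  · rcases lt_or_ge c d with hcd | hdc
    · have hcb : c < b := by
        by_contra hbc
        have hbc := lt_of_le_of_ne (not_lt.1 hbc) hne.1
        exact hmin ⟨hbc, hbc.trans hcd⟩
      rw [← hO.rotate v hv b hb c hc d hd hn, ← hO'.rotate v hv b hb c hc d hd hn]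
      exact hsmallest c hc d hd b hb hn₁ hcd hcb
    · have hdc := lt_of_le_of_ne hdc hne.2.2.symm
      have hdb : d < b := by
        by_contra hbd
        have hbd := lt_of_le_of_ne (not_lt.1 hbd) hne.2.1
        exact hmin ⟨hbd.trans hdc, hbd⟩
      rw [hO.rotate v hv d hd b hb c hc hn₂, hO'.rotate v hv d hd b hb c hc hn₂]
      exact hsmallest d hd b hb c hc hn₂ hdb hdc

section Chi

variable {α : Type*} [Fintype α] [DecidableEq α]

/-- The orientation function of a pre-rotation system. -/
noncomputable def PreRotSys.orient (P : PreRotSys α) (v b c d : α) : Bool :=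
  open Classical in decide (rotOrd P v b c d)

theorem PreRotSys.orient_eq_true (P : PreRotSys α) {v b c d : α} :
    P.orient v b c d = true ↔ rotOrd P v b c d := by
  simp [orient]

theorem PreRotSys.orient_rotate (P : PreRotSys α) {v b c d : α} (h : [v, b, c, d].Nodup) :
    P.orient v c d b = P.orient v b c d := by
  have hb : b ∈ Finset.univ.erase v := by simp_all [eq_comm]
  have hc : c ∈ Finset.univ.erase v := by simp_all [eq_comm]
  have hd : d ∈ Finset.univ.erase v := by simp_all [eq_comm]
  rw [Bool.eq_iff_iff, orient_eq_true, orient_eq_true]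
  exact ⟨fun h => (h.rotate (P.cyc v) hc).rotate (P.cyc v) hd, fun h => h.rotate (P.cyc v) hb⟩

theorem PreRotSys.orient_swap (P : PreRotSys α) {v b c d : α} (h : [v, b, c, d].Nodup) :
    P.orient v b d c = !P.orient v b c d := by
  have hb : b ∈ Finset.univ.erase v := by simp_all [eq_comm]
  have hc : c ∈ Finset.univ.erase v := by simp_all [eq_comm]
  have hd : d ∈ Finset.univ.erase v := by simp_all [eq_comm]
  have ht := CycOrd.total (P.cyc v) hb hc hd (by simp_all) (by simp_all) (by simp_all)
  rw [Bool.eq_iff_iff, Bool.not_eq_true', ← Bool.not_eq_true, orient_eq_true, orient_eq_true]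
  exact ⟨fun h => h.asymm (P.cyc v) hb, ht.resolve_left⟩

theorem PreRotSys.orient_trans (P : PreRotSys α) {v b c d e : α} (hb : v ≠ b)
    (h : P.orient v b c d = true) (h' : P.orient v b d e = true) : P.orient v b c e = true := by
  rw [orient_eq_true] at *
  exact CycOrd.trans (P.cyc v) (by simp [hb.symm]) h h'

theorem PreRotSys.isOrientationOn (P : PreRotSys α) : IsOrientationOn P.orient Set.univ :=
  ⟨fun _ _ _ _ _ _ _ _ h => P.orient_rotate h, fun _ _ _ _ _ _ _ _ h => P.orient_swap h⟩

theorem PreRotSys.orient_trans_eq (P : PreRotSys α) {v b c d e : α} (h : [v, b, c, d, e].Nodup)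
    (hbd : P.orient v b c d = P.orient v b d e) : P.orient v b c e = P.orient v b c d := by
  have hn : v ≠ b ∧ v ≠ c ∧ v ≠ d ∧ v ≠ e ∧ b ≠ c ∧ b ≠ d ∧ b ≠ e ∧ c ≠ d ∧ c ≠ e ∧ d ≠ e := by
    simp only [List.nodup_cons, List.mem_cons, not_or] at h
    tauto
  have hbcd := P.orient_swap (v := v) (b := b) (c := c) (d := d) (by simp_all)
  have hbce := P.orient_swap (v := v) (b := b) (c := c) (d := e) (by simp_all)
  have hbde := P.orient_swap (v := v) (b := b) (c := d) (d := e) (by simp_all)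
  cases hv : P.orient v b c d
  · have := P.orient_trans (b := b) (c := e) (d := d) (e := c) hn.1 (by simp_all) (by simp_all)
    simp_all
  · exact P.orient_trans hn.1 hv (hbd ▸ hv)

/-- The orientations of the four triples in a cyclic order on four elements. -/
theorem PreRotSys.orient_eq_of_eq (P : PreRotSys α) {v b c d e : α}
    (h : [v, b, c, d, e].Nodup) :
    (P.orient v b c d = P.orient v b d e → P.orient v b c e = P.orient v b c d ∧
      P.orient v c d e = P.orient v b c d) ∧
    (P.orient v b c e = P.orient v c d e → P.orient v b c d = P.orient v b c e ∧
      P.orient v b d e = P.orient v b c e) := by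
  have hb := P.orient_trans_eq h
  have hc := P.orient_trans_eq (v := v) (b := c) (c := d) (d := e) (e := b) (by grind)
  have hd := P.orient_trans_eq (v := v) (b := d) (c := e) (d := b) (e := c) (by grind)
  have he := P.orient_trans_eq (v := v) (b := e) (c := b) (d := c) (e := d) (by grind)
  have rotate {b c d : α} (h : [v, b, c, d].Nodup) := P.orient_rotate h
  have r₁ := rotate (b := b) (c := c) (d := d) (by grind)
  have r₂ := rotate (b := d) (c := b) (d := c) (by grind)
  have r₃ := rotate (b := b) (c := c) (d := e) (by grind)
  have r₄ := rotate (b := e) (c := b) (d := c) (by grind)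
  have r₅ := rotate (b := b) (c := d) (d := e) (by grind)
  have r₆ := rotate (b := e) (c := b) (d := d) (by grind)
  have r₇ := rotate (b := c) (c := d) (d := e) (by grind)
  have r₈ := rotate (b := e) (c := c) (d := d) (by grind)
  grind

end Chi

/-! ### Generalized twisted systems in terms of orientations -/

/-- The criterion for the edges `{p, r}` and `{q, s}` to cross. -/
def crossing {ι : Type*} (O : ι → ι → ι → ι → Bool) (p q r s : ι) : Bool :=
  (O p q r s && O q p r s && O r p q s && O s p q r) ||
    (O p q s r && O q p s r && O r p s q && O s p r q)

theorem PreRotSys.crosses_iff {α : Type*} [Fintype α] [DecidableEq α] (P : PreRotSys α)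
    {p q r s : α} : Crosses P p q r s ↔ [p, q, r, s].Nodup ∧ crossing P.orient p q r s = true := by
  simp only [Crosses, crossing, Bool.or_eq_true, Bool.and_eq_true, orient_eq_true, List.nodup_cons,
    List.mem_cons, List.not_mem_nil, not_or, List.nodup_nil, or_false, not_false_eq_true]
  tauto

theorem isOrientationOn_twistedOrient (p : Equiv.Perm (Fin 5)) (f : Bool) :
    IsOrientationOn (fun i j k l : Fin 5 => twistedOrient (p i) (p j) (p k) (p l) ^^ f)
      Set.univ := by
  have key : ∀ v b c d : Fin 5, [v, b, c, d].Nodup →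
      twistedOrient v c d b = twistedOrient v b c d ∧
      twistedOrient v b d c = !twistedOrient v b c d := by decide +kernel
  have map {v b c d : Fin 5} (h : [v, b, c, d].Nodup) : [p v, p b, p c, p d].Nodup :=
    List.Nodup.map (l := [v, b, c, d]) p.injective h
  exact ⟨fun v _ b _ c _ d _ h => by rw [(key _ _ _ _ (map h)).1],
    fun v _ b _ c _ d _ h => by rw [(key _ _ _ _ (map h)).2, Bool.not_xor]⟩

/-- The members of `w` form a relabelling, possibly reflected, of the perfect twisted system. -/
def IsTwistedOn {α : Type*} (O : α → α → α → α → Bool) (w : Fin 5 → α) : Prop :=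
  ∃ (p : Equiv.Perm (Fin 5)) (f : Bool), ∀ i j k l, [i, j, k, l].Nodup →
    O (w i) (w j) (w k) (w l) = (twistedOrient (p i) (p j) (p k) (p l) ^^ f)

theorem IsTwistedOn.of_comp {α : Type*} {O : α → α → α → α → Bool} {w : Fin 5 → α}
    (e : Equiv.Perm (Fin 5)) (h : IsTwistedOn O (w ∘ e)) : IsTwistedOn O w := by
  obtain ⟨p, f, h⟩ := h
  refine ⟨e.symm.trans p, f, fun i j k l hn => ?_⟩
  simpa using h (e.symm i) (e.symm j) (e.symm k) (e.symm l)
    (List.Nodup.map (l := [i, j, k, l]) e.symm.injective hn)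

section

variable {α : Type*} [Fintype α] [DecidableEq α] {P : PreRotSys α} {w : Fin 5 → α}

theorem TwistedTuple.exists_orient_eq (hw : Function.Injective w) (h : TwistedTuple P w) :
    ∃ f : Bool, ∀ i j k l, [i, j, k, l].Nodup →
      P.orient (w i) (w j) (w k) (w l) = (twistedOrient i j k l ^^ f) := by
  have hX := P.isOrientationOn.comp hw.injOn (Set.mapsTo_univ _ Set.univ)
  set X : Fin 5 → Fin 5 → Fin 5 → Fin 5 → Bool :=
    fun i j k l => P.orient (w i) (w j) (w k) (w l) with hXdef
  have cross (a b c d : Fin 5) (hab : a < b) (hbc : b < c) (hcd : c < d) :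
      X b a c d = X a b c d ∧ (X c a b d = !X a b c d) ∧ (X d a b c = !X a b c d) := by
    have hc := (P.crosses_iff.1 (h a b c d hab hbc hcd).1).2
    have hn : [a, b, c, d].Nodup := by simp; omega
    have s₁ := hX.swap a trivial b trivial c trivial d trivial hn
    have s₂ := hX.swap b trivial a trivial c trivial d trivial (by simp; omega)
    have s₃ := hX.swap c trivial a trivial b trivial d trivial (by simp; omega)
    have s₄ := hX.swap d trivial a trivial b trivial c trivial (by simp; omega)
    have hc : crossing X a b d c = true := by simpa only [hXdef, crossing] using hc
    clear_value X
    revert hc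
    rw [crossing, s₁, s₂, s₃, s₄]
    generalize X a b c d = x, X b a c d = y, X c a b d = z, X d a b c = t
    revert x y z t
    decide
  have valid (v b c d e : Fin 5) (hn : [v, b, c, d, e].Nodup) :
      (X v b c d = X v b d e → X v b c e = X v b c d ∧ X v c d e = X v b c d) ∧
      (X v b c e = X v c d e → X v b c d = X v b c e ∧ X v b d e = X v b c e) := by
    simpa only [hXdef] using
      P.orient_eq_of_eq (List.Nodup.map (l := [v, b, c, d, e]) hw hn)
  refine ⟨!X 0 1 2 3, fun i j k l hn => ?_⟩
  have := hX.eq_of_increasing (isOrientationOn_twistedOrient (Equiv.refl _) (!X 0 1 2 3))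
    (v := i) (b := j) (c := k) (d := l) trivial ?_ trivial trivial trivial hn
  · simpa [hXdef] using this
  · have c₄ := cross 0 1 2 3 (by decide) (by decide) (by decide)
    have c₃ := cross 0 1 2 4 (by decide) (by decide) (by decide)
    have c₂ := cross 0 1 3 4 (by decide) (by decide) (by decide)
    have c₁ := cross 0 2 3 4 (by decide) (by decide) (by decide)
    have c₀ := cross 1 2 3 4 (by decide) (by decide) (by decide)
    have v₀ := valid 0 1 2 3 4 (by decide)
    have v₁ := valid 1 0 2 3 4 (by decide)
    have v₂ := valid 2 0 1 3 4 (by decide)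
    have v₃ := valid 3 0 1 2 4 (by decide)
    have v₄ := valid 4 0 1 2 3 (by decide)
    clear_value X
    have key : ∀ s₄ s₃ s₂ s₁ s₀ : Bool,
      ((s₄ = s₂ → s₃ = s₄ ∧ s₁ = s₄) ∧ (s₃ = s₁ → s₄ = s₃ ∧ s₂ = s₃)) →
      ((s₄ = s₂ → s₃ = s₄ ∧ s₀ = s₄) ∧ (s₃ = s₀ → s₄ = s₃ ∧ s₂ = s₃)) →
      (((!s₄) = s₁ → s₃ = s₄ ∧ s₀ = !s₄) ∧ ((!s₃) = s₀ → s₄ = s₃ ∧ s₁ = !s₃)) →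
      ((s₄ = s₁ → s₂ = s₄ ∧ s₀ = s₄) ∧ (s₂ = s₀ → s₄ = s₂ ∧ s₁ = s₂)) →
      s₃ = s₄ ∧ s₂ = s₄ ∧ s₁ = s₄ ∧ s₀ = s₄ := by decide
    have heq := key (X 0 1 2 3) (X 0 1 2 4) (X 0 1 3 4) (X 0 2 3 4) (X 1 2 3 4) v₀
      (by simpa only [c₄.1, c₃.1, c₂.1] using v₁)
      (by simpa only [c₄.2.1, c₃.2.1, c₁.1, c₀.1, Bool.not_inj_iff] using v₂)
      (by simpa only [c₄.2.2, c₂.2.1, c₁.2.1, c₀.2.1, Bool.not_inj_iff] using v₃)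
    obtain ⟨h₃, h₂, h₁, h₀⟩ := heq
    have increasing (a b c d : Fin 5) : a < b ∧ b < c ∧ c < d → X a b c d = X 0 1 2 3 := by
      intro h
      have : ∀ a b c d : Fin 5, a < b ∧ b < c ∧ c < d → (a, b, c, d) ∈
          [(0, 1, 2, 3), (0, 1, 2, 4), (0, 1, 3, 4), (0, 2, 3, 4), (1, 2, 3, 4)] := by decide
      have := this a b c d h
      simp only [List.mem_cons, Prod.mk.injEq, List.not_mem_nil, or_false] at this
      rcases this with ⟨rfl, rfl, rfl, rfl⟩ | ⟨rfl, rfl, rfl, rfl⟩ | ⟨rfl, rfl, rfl, rfl⟩ |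
        ⟨rfl, rfl, rfl, rfl⟩ | ⟨rfl, rfl, rfl, rfl⟩
      exacts [rfl, h₃, h₂, h₁, h₀]
    have twisted : ∀ a b c d : Fin 5, a < b ∧ b < c ∧ c < d → twistedOrient a b c d = true ∧
        twistedOrient b a c d = true ∧ twistedOrient c a b d = false ∧
        twistedOrient d a b c = false := by decide +kernel
    generalize i = v
    intro b _ c _ d _ hn hbc hcd
    have hv : v ≠ b ∧ v ≠ c ∧ v ≠ d := by simp at hn; tauto
    simp only [Equiv.refl_apply]
    rcases lt_or_gt_of_ne hv.1 with h | hb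
    · simp [increasing v b c d ⟨h, hbc, hcd⟩, twisted v b c d ⟨h, hbc, hcd⟩]
    rcases lt_or_gt_of_ne hv.2.1 with h | hc
    · simp [increasing b v c d ⟨hb, h, hcd⟩, twisted b v c d ⟨hb, h, hcd⟩,
        cross b v c d hb h hcd]
    rcases lt_or_gt_of_ne hv.2.2 with h | hd
    · simp [increasing b c v d ⟨hbc, hc, h⟩, twisted b c v d ⟨hbc, hc, h⟩,
        cross b c v d hbc hc h]
    · simp [increasing b c d v ⟨hbc, hcd, hd⟩, twisted b c d v ⟨hbc, hcd, hd⟩,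
        cross b c d v hbc hcd hd]

theorem twistedTuple_of_orient_eq (hw : Function.Injective w) {f : Bool}
    (h : ∀ i j k l, [i, j, k, l].Nodup →
      P.orient (w i) (w j) (w k) (w l) = (twistedOrient i j k l ^^ f)) : TwistedTuple P w := by
  have crosses (i j k l : Fin 5) (hn : [i, j, k, l].Nodup) :
      Crosses P (w i) (w j) (w k) (w l) ↔
        crossing (fun i j k l : Fin 5 => twistedOrient i j k l ^^ f) i j k l = true := by
    have hwn : [w i, w j, w k, w l].Nodup := List.Nodup.map (l := [i, j, k, l]) hw hn
    rw [P.crosses_iff, and_iff_right hwn]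
    rw [crossing, h i j k l hn, h j i k l (by grind), h k i j l (by grind), h l i j k (by grind),
      h i j l k (by grind), h j i l k (by grind), h k i l j (by grind), h l i k j (by grind),
      crossing]
  have key : ∀ f : Bool, ∀ a b c d : Fin 5, a < b → b < c → c < d →
      crossing (fun i j k l : Fin 5 => twistedOrient i j k l ^^ f) a b d c = true ∧
      ¬ crossing (fun i j k l : Fin 5 => twistedOrient i j k l ^^ f) a c b d = true ∧
      ¬ crossing (fun i j k l : Fin 5 => twistedOrient i j k l ^^ f) a b c d = true := by
    decide +kernel
  intro a b c d hab hbc hcd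
  rw [crosses a b d c (by simp; omega), crosses a c b d (by simp; omega),
    crosses a b c d (by simp; omega)]
  exact key f a b c d hab hbc hcd

end

theorem GenTwisted.isTwistedOn {α : Type*} [Fintype α] [DecidableEq α] {P : PreRotSys α}
    (hP : GenTwisted P) {w : Fin 5 → α} (hw : Function.Injective w) : IsTwistedOn P.orient w := by
  obtain ⟨e, he⟩ := hP.2 w hw
  obtain ⟨f, hf⟩ := TwistedTuple.exists_orient_eq (w := w ∘ e) (hw.comp e.injective) he
  exact IsTwistedOn.of_comp e ⟨Equiv.refl _, f, hf⟩

theorem genTwisted_of_isTwistedOn {α : Type*} [Fintype α] [LinearOrder α]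
    (hα : 5 ≤ Fintype.card α) {P : PreRotSys α}
    (h : ∀ w : Fin 5 → α, StrictMono w → IsTwistedOn P.orient w) : GenTwisted P := by
  have h' (w : Fin 5 → α) (hw : Function.Injective w) : IsTwistedOn P.orient w :=
    IsTwistedOn.of_comp (Tuple.sort w) (h _ ((Tuple.monotone_sort w).strictMono_of_injective
      (hw.comp (Tuple.sort w).injective)))
  constructor
  · intro a b c d hab hac had hbc hbd hcd
    obtain ⟨e, he⟩ : ∃ e, e ∉ ({a, b, c, d} : Finset α) := by
      by_contra hall
      have : Finset.univ ⊆ ({a, b, c, d} : Finset α) := fun x _ => by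
        by_contra hx
        exact hall ⟨x, hx⟩
      have := Finset.card_le_card this
      have := Finset.card_le_four (a := a) (b := b) (c := c) (d := d)
      rw [Finset.card_univ] at *
      omega
    have hw : Function.Injective ![a, b, c, d, e] := by
      rw [← List.nodup_ofFn]
      simp [List.ofFn_succ]
      simp at he
      tauto
    obtain ⟨p, f, hp⟩ := h' _ hw
    have key : ∀ f : Bool, ∀ x y z t : Fin 5, [x, y, z, t].Nodup →
        ¬ ((twistedOrient x y z t ^^ f) = true ∧ (twistedOrient y x z t ^^ f) = true ∧
          (twistedOrient z x y t ^^ f) = true ∧ (twistedOrient t x z y ^^ f) = true) := by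
      decide +kernel
    have hpn (i j k l : Fin 5) (hn : [i, j, k, l].Nodup) : [p i, p j, p k, p l].Nodup :=
      List.Nodup.map (l := [i, j, k, l]) p.injective hn
    have swap (i j k l : Fin 5) (hn : [i, j, k, l].Nodup) :=
      (isOrientationOn_twistedOrient p f).swap i trivial j trivial k trivial l trivial hn
    have h₁ := hp 0 1 2 3 (by decide)
    have h₂ := hp 1 0 2 3 (by decide)
    have h₃ := hp 2 0 1 3 (by decide)
    have h₄ := hp 3 0 2 1 (by decide)
    have h₅ := hp 0 1 3 2 (by decide)
    have h₆ := hp 1 0 3 2 (by decide)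
    have h₇ := hp 2 0 3 1 (by decide)
    have h₈ := hp 3 0 1 2 (by decide)
    have k₁ := key f (p 0) (p 1) (p 2) (p 3) (hpn 0 1 2 3 (by decide))
    have k₂ := key (!f) (p 0) (p 1) (p 2) (p 3) (hpn 0 1 2 3 (by decide))
    simp only [Matrix.cons_val] at h₁ h₂ h₃ h₄ h₅ h₆ h₇ h₈
    simp only [← P.orient_eq_true, h₁, h₂, h₃, h₄]
    refine ⟨k₁, ?_⟩
    rw [h₅, h₆, h₇, h₈]
    rw [swap 0 1 2 3 (by decide), swap 1 0 2 3 (by decide), swap 2 0 1 3 (by decide),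
      swap 3 0 2 1 (by decide)]
    simpa only [Bool.xor_not] using k₂
  · intro w hw
    obtain ⟨p, f, hp⟩ := h' w hw
    refine ⟨p.symm, twistedTuple_of_orient_eq (hw.comp p.symm.injective) (f := f) ?_⟩
    intro i j k l hn
    simpa using hp _ _ _ _ (List.Nodup.map (l := [i, j, k, l]) p.symm.injective hn)

/-- The orientations of an increasing quadruple at its first three members, as an octal digit. -/
def digit (O : ℕ → ℕ → ℕ → ℕ → Bool) (a b c d : ℕ) : ℕ :=
  (O a b c d).toNat + 2 * (O b a c d).toNat + 4 * (O c a b d).toNat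

/-- The digits of the five quadruples of an increasing quintuple. -/
def digits5 (O : ℕ → ℕ → ℕ → ℕ → Bool) (a b c d e : ℕ) : ℕ × ℕ × ℕ × ℕ × ℕ :=
  (digit O a b c d, digit O a b c e, digit O a b d e, digit O a c d e, digit O b c d e)

/-- The orientation function `O`, relabelled along `p` and reflected if `f`. -/
def transport (O : ℕ → ℕ → ℕ → ℕ → Bool) (p : ℕ → ℕ) (f : Bool) (v b c d : ℕ) : Bool :=
  O (p v) (p b) (p c) (p d) ^^ f

/-- The digit tuples of all relabellings of the perfect twisted system on five elements. -/
def twistedDigits : List (ℕ × ℕ × ℕ × ℕ × ℕ) :=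
  [false, true].flatMap fun f => (List.permutations' [0, 1, 2, 3, 4]).map fun l =>
    digits5 (transport twistedOrient (fun i => l.getD i 0) f) 0 1 2 3 4

/-- The number whose binary digit `i` is `1` exactly for the members `i` of `l`. -/
def bitSet (l : List ℕ) : ℕ := l.foldr (fun i m => m ||| 1 <<< i) 0

def prefixes2 : ℕ := bitSet (twistedDigits.map fun s => 8 * s.1 + s.2.1)

def prefixes3 : ℕ := bitSet (twistedDigits.map fun s => 8 * (s.1 + 8 * s.2.1) + s.2.2.1)

def prefixes4 : ℕ :=
  bitSet (twistedDigits.map fun s => 8 * (s.1 + 8 * s.2.1 + 64 * s.2.2.1) + s.2.2.2.1)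

def prefixes5 : ℕ :=
  bitSet (twistedDigits.map fun s =>
    8 * (s.1 + 8 * s.2.1 + 64 * s.2.2.1 + 512 * s.2.2.2.1) + s.2.2.2.2)

/-- The increasing quadruples below `8`, in colexicographic order. -/
def quads : List (ℕ × ℕ × ℕ × ℕ) :=
  (List.range 8).flatMap fun d => (List.range d).flatMap fun c => (List.range c).flatMap fun b =>
    (List.range b).map fun a => (a, b, c, d)

def quad (i : ℕ) : ℕ × ℕ × ℕ × ℕ := quads.getD i (0, 0, 0, 0)

/-- The index of an increasing quadruple in `quads`. -/
def pos (a b c d : ℕ) : ℕ :=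
  ((a.add ((b.mul (b.sub 1)).div 2)).add (((c.mul (c.sub 1)).mul (c.sub 2)).div 6)).add
    ((((d.mul (d.sub 1)).mul (d.sub 2)).mul (d.sub 3)).div 24)

def octal (N i : ℕ) : ℕ := (N.shiftRight (Nat.mul 3 i)).land 7

/-- The digit of `N` for the quadruple `(a, b, c, d)`. -/
def quadDigit (N a b c d : ℕ) : ℕ := octal N (pos a b c d)

/-- The condition that the digits for the quadruples on `x, y, z, d, w` impose on the digit for
`(x, y, z, d)`, given those of smaller index: a set of digit sequences, and the indices of the
quadruples whose digits precede the unknown one. -/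
def constraint (x y z d w : ℕ) : ℕ × List ℕ :=
  bif w.blt x then (prefixes5, [pos w x y z, pos w x y d, pos w x z d, pos w y z d])
  else bif w.beq x then (255, [])
  else bif w.blt y then (prefixes4, [pos x w y z, pos x w y d, pos x w z d])
  else bif w.beq y then (255, [])
  else bif w.blt z then (prefixes3, [pos x y w z, pos x y w d])
  else bif w.beq z then (255, [])
  else (prefixes2, [pos x y z w])

/-- The quadruples with largest element `d`, in order, with the constraints on their digits. -/
def plan (d : ℕ) : List (ℕ × List (ℕ × List ℕ)) :=
  (List.range d).flatMap fun z => (List.range z).flatMap fun y =>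
    (List.range y).map fun x => (pos x y z d, (List.range d).map (constraint x y z d))

/-- The digits of `N` at the positions in `l`, as the digits of a number. -/
noncomputable def lookup (N : ℕ) (l : List ℕ) : ℕ :=
  List.rec 0 (fun i _ n => (octal N i).add (Nat.mul 8 n)) l

/-- The set of digits that satisfy all the constraints in `l`. -/
noncomputable def allowed (N : ℕ) (l : List (ℕ × List ℕ)) : ℕ :=
  List.rec 255 (fun c _ m => m.land (c.1.shiftRight (Nat.mul 8 (lookup N c.2)))) l

/-- Does `leaf` hold for all codes that extend a given one by digits that are compatible with the
constraints in `l`? The recursors make the evaluation in the kernel faster. -/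
noncomputable def search (leaf : ℕ → Bool) (l : List (ℕ × List (ℕ × List ℕ))) : ℕ → Bool :=
  List.rec (motive := fun _ => ℕ → Bool) leaf
    (fun p _ next N =>
      (fun m => List.rec true
        (fun s _ rest => Bool.rec false rest
          (Nat.rec true (fun _ _ => next (N.add (s.shiftLeft (Nat.mul 3 p.1))))
            ((m.shiftRight s).land 1)))
        [0, 1, 3, 4, 6, 7])
      (allowed N p.2)) l

/-- The binary digit of `n` with index `i`. -/
def bitAt (n i : ℕ) : Bool := ((n.shiftRight i).land 1).beq 1

/-- The orientation at `v` of an increasing triple, decoded from `N`. -/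
def decodeSorted (N v b c d : ℕ) : Bool :=
  bif v.blt b then bitAt (quadDigit N v b c d) 0
  else bif v.blt c then bitAt (quadDigit N b v c d) 1
  else bif v.blt d then bitAt (quadDigit N b c v d) 2
  else xor (xor (bitAt (quadDigit N b c d v) 0) (bitAt (quadDigit N b c d v) 1))
    (bitAt (quadDigit N b c d v) 2)

/-- The orientation function with code `N`. -/
def decode (N v b c d : ℕ) : Bool :=
  bif b.blt c then
    bif c.blt d then decodeSorted N v b c d
    else bif b.blt d then !decodeSorted N v b d c
    else decodeSorted N v d b c
  else
    bif b.blt d then !decodeSorted N v c b d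
    else bif c.blt d then decodeSorted N v c d b
    else !decodeSorted N v d c b

/-- `N` and `R` have the same first `m` digits after relabelling `N` along `p` (which permutes the
numbers up to `k`) and possibly reflecting. -/
def isTransport (k m N R : ℕ) (p : ℕ → ℕ) (f : Bool) : Bool :=
  (R >>> (3 * m)).beq 0 &&
  ((List.range m).all fun i =>
    (digit (transport (decode N) p f) (quad i).1 (quad i).2.1 (quad i).2.2.1 (quad i).2.2.2).beq
      (octal R i)) &&
  ((List.range 8).all fun x => (List.range x).all fun y => !(p x).beq (p y)) &&
  ((List.range 8).all fun x => (p x).blt 8) &&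
  ((List.range (k + 1)).all fun x => (p x).ble k)

/-- `c` encodes a relabelling of `N` into a member of `reps`. -/
def certifies (k m : ℕ) (reps : List ℕ) (N c : ℕ) : Bool :=
  (N % 1297).beq (c >>> 31) &&
    reps[(c >>> 25) &&& 63]?.any fun R => isTransport k m N R (octal c) (c.testBit 24)

/-- Every compatible extension to `k + 1` elements of a code in `reps` is a relabelling of a code
in `reps'`. -/
noncomputable def extensionsCovered (k : ℕ) (reps reps' : List ℕ) (certs : List (List ℕ)) : Bool :=
  (reps.zip certs).all fun r =>
    search (fun N => r.2.any (certifies k ((k + 1).choose 4) reps' N)) (plan k) r.1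

/-! ### Numbered systems -/

/-- Any five numbers below `8` form a relabelling of the perfect twisted system. -/
def IsTwistedSystem (O : ℕ → ℕ → ℕ → ℕ → Bool) : Prop :=
  ∀ w : Fin 5 → ℕ, Function.Injective w → (∀ i, w i < 8) → IsTwistedOn O w

/-- `p` restricts to a permutation of the numbers below `8`. -/
def PermutesBelow (p : ℕ → ℕ) : Prop :=
  Set.MapsTo p (Set.Iio 8) (Set.Iio 8) ∧ Set.InjOn p (Set.Iio 8)

section

variable {O : ℕ → ℕ → ℕ → ℕ → Bool}

theorem IsTwistedSystem.transport (hO : IsTwistedSystem O) {p : ℕ → ℕ} (hp : PermutesBelow p)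
    (r : Bool) : IsTwistedSystem (transport O p r) := by
  intro w hw hw8
  obtain ⟨q, f, h⟩ := hO (p ∘ w) (fun i j hij => hw (hp.2 (hw8 i) (hw8 j) hij))
    fun i => hp.1 (hw8 i)
  exact ⟨q, f ^^ r, fun i j k l hn => by
    simpa [_root_.transport] using congrArg (fun x => x ^^ r) (h i j k l hn)⟩

/-- A statement about four vertices of a twisted system can be checked on the perfect one. -/
theorem IsTwistedSystem.exists_eq (hO : IsTwistedSystem O) {a b c d : ℕ}
    (ha : a < 8) (hb : b < 8) (hc : c < 8) (hd : d < 8) (hn : [a, b, c, d].Nodup) :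
    ∃ (p : Equiv.Perm (Fin 5)) (f : Bool), ∀ i j k l : Fin 4, [i, j, k, l].Nodup →
      O (![a, b, c, d] i) (![a, b, c, d] j) (![a, b, c, d] k) (![a, b, c, d] l) =
        (twistedOrient (p i.castSucc) (p j.castSucc) (p k.castSucc) (p l.castSucc) ^^ f) := by
  obtain ⟨e, he, he'⟩ : ∃ e ∈ Finset.range 8, e ∉ ({a, b, c, d} : Finset ℕ) :=
    Finset.exists_mem_notMem_of_card_lt_card (Finset.card_le_four.trans_lt (by simp))
  obtain ⟨p, f, h⟩ := hO (Fin.snoc ![a, b, c, d] e) (by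
    rw [← List.nodup_ofFn]
    simp [List.ofFn_succ]
    simp at he' hn
    tauto) (fun i => by
      induction i using Fin.lastCases with
      | last => simpa using he
      | cast i => rw [Fin.snoc_castSucc]; fin_cases i <;> assumption)
  refine ⟨p, f, fun i j k l hn => ?_⟩
  simpa only [Fin.snoc_castSucc] using h i.castSucc j.castSucc k.castSucc l.castSucc
    (List.Nodup.map (l := [i, j, k, l]) (Fin.castSucc_injective 4) hn)

theorem IsTwistedSystem.forall_of_forall (hO : IsTwistedSystem O)
    {Q : Bool → Bool → Bool → Bool → Bool → Bool → Prop}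
    (hQ : ∀ f : Bool, ∀ x y z t : Fin 5, [x, y, z, t].Nodup →
      Q (twistedOrient x y z t ^^ f) (twistedOrient x z t y ^^ f) (twistedOrient x y t z ^^ f)
        (twistedOrient y x z t ^^ f) (twistedOrient z x y t ^^ f) (twistedOrient t x y z ^^ f))
    {a b c d : ℕ} (ha : a < 8) (hb : b < 8) (hc : c < 8) (hd : d < 8)
    (hn : [a, b, c, d].Nodup) :
    Q (O a b c d) (O a c d b) (O a b d c) (O b a c d) (O c a b d) (O d a b c) := by
  obtain ⟨p, f, h⟩ := hO.exists_eq ha hb hc hd hn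
  have hp := hQ f (p 0) (p 1) (p 2) (p 3)
    (List.Nodup.map (l := [0, 1, 2, 3]) p.injective (by decide))
  have h₁ := h 0 1 2 3 (by decide)
  have h₂ := h 0 2 3 1 (by decide)
  have h₃ := h 0 1 3 2 (by decide)
  have h₄ := h 1 0 2 3 (by decide)
  have h₅ := h 2 0 1 3 (by decide)
  have h₆ := h 3 0 1 2 (by decide)
  simp only [Matrix.cons_val] at h₁ h₂ h₃ h₄ h₅ h₆
  rw [h₁, h₂, h₃, h₄, h₅, h₆]
  exact hp

theorem IsTwistedSystem.isOrientationOn (hO : IsTwistedSystem O) :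
    IsOrientationOn O (Set.Iio 8) where
  rotate _ hv _ hb _ hc _ hd hn :=
    hO.forall_of_forall (Q := fun x y _ _ _ _ => y = x) (by decide +kernel) hv hb hc hd hn
  swap _ hv _ hb _ hc _ hd hn :=
    hO.forall_of_forall (Q := fun x _ y _ _ _ => y = !x) (by decide +kernel) hv hb hc hd hn

theorem nodup_of_lt {a b c d : ℕ} (hab : a < b) (hbc : b < c) (hcd : c < d) :
    [a, b, c, d].Nodup := by
  simp
  omega

theorem IsTwistedSystem.parity (hO : IsTwistedSystem O) {a b c d : ℕ} (hab : a < b) (hbc : b < c)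
    (hcd : c < d) (hd : d < 8) : O d a b c = ((O a b c d ^^ O b a c d) ^^ O c a b d) :=
  hO.forall_of_forall (Q := fun x _ _ y z t => t = ((x ^^ y) ^^ z)) (by decide +kernel)
    (by omega) (by omega) (by omega) hd (nodup_of_lt hab hbc hcd)

theorem IsTwistedSystem.digit_mem (hO : IsTwistedSystem O) {a b c d : ℕ} (hab : a < b) (hbc : b < c)
    (hcd : c < d) (hd : d < 8) : digit O a b c d ∈ [0, 1, 3, 4, 6, 7] :=
  hO.forall_of_forall (Q := fun x _ _ y z _ =>
      x.toNat + 2 * y.toNat + 4 * z.toNat ∈ [0, 1, 3, 4, 6, 7]) (by decide +kernel)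
    (by omega) (by omega) (by omega) hd (nodup_of_lt hab hbc hcd)

theorem IsTwistedSystem.digits5_mem (hO : IsTwistedSystem O) {a b c d e : ℕ} (hab : a < b)
    (hbc : b < c) (hcd : c < d) (hde : d < e) (he : e < 8) :
    digits5 O a b c d e ∈ twistedDigits := by
  obtain ⟨p, f, h⟩ := hO ![a, b, c, d, e] (by
    rw [← List.nodup_ofFn]
    simp [List.ofFn_succ]
    omega) (fun i => by fin_cases i <;> simp <;> omega)
  refine List.mem_flatMap.2 ⟨f, by simp, List.mem_map.2
    ⟨(List.finRange 5).map fun i => (p i : ℕ), ?_, ?_⟩⟩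
  · rw [List.mem_permutations']
    have := (List.Perm.map Fin.val (Equiv.Perm.map_finRange_perm p))
    rw [List.map_map] at this
    exact this
  · have getD (i : Fin 5) : ((List.finRange 5).map fun i => (p i : ℕ)).getD i 0 = p i := by
      fin_cases i <;> rfl
    have digit_eq (i j k l : Fin 5) (hn : [i, j, k, l].Nodup) :
        digit (_root_.transport twistedOrient
          (fun i => ((List.finRange 5).map fun i => (p i : ℕ)).getD i 0) f) i j k l =
        digit O (![a, b, c, d, e] i) (![a, b, c, d, e] j) (![a, b, c, d, e] k)
          (![a, b, c, d, e] l) := by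
      simp only [digit, _root_.transport, getD]
      rw [h i j k l hn, h j i k l (by grind), h k i j l (by grind)]
    simp only [digits5, Prod.mk.injEq]
    exact ⟨digit_eq 0 1 2 3 (by decide), digit_eq 0 1 2 4 (by decide),
      digit_eq 0 1 3 4 (by decide), digit_eq 0 2 3 4 (by decide), digit_eq 1 2 3 4 (by decide)⟩

end

/-! ### Codes -/

/-- The first `m` octal digits of `N`, which has no others, encode `O` on the first `m` increasing
quadruples. -/
def Codes (O : ℕ → ℕ → ℕ → ℕ → Bool) (m N : ℕ) : Prop :=
  N < 2 ^ (3 * m) ∧ ∀ a b c d, a < b → b < c → c < d → d < 8 → pos a b c d < m →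
    octal N (pos a b c d) = digit O a b c d

theorem octal_eq (N i : ℕ) : octal N i = N / 2 ^ (3 * i) % 8 := by
  change (N >>> (3 * i)) &&& (2 ^ 3 - 1) = _
  rw [Nat.and_two_pow_sub_one_eq_mod, Nat.shiftRight_eq_div_pow]

theorem quad_pos {a b c d : ℕ} (hab : a < b) (hbc : b < c) (hcd : c < d) (hd : d < 8) :
    quad (pos a b c d) = (a, b, c, d) := by
  have : ∀ d < 8, ∀ c < d, ∀ b < c, ∀ a < b,
      (quad (pos a b c d) == (a, b, c, d)) = true := by
    decide +kernel
  exact eq_of_beq (this d hd c hcd b hbc a hab)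

theorem pos_lt_choose {a b c d k : ℕ} (hab : a < b) (hbc : b < c) (hcd : c < d) (hdk : d < k)
    (hk : k ≤ 8) : pos a b c d < k.choose 4 := by
  have : ∀ k < 9, ∀ d < k, ∀ c < d, ∀ b < c, ∀ a < b, pos a b c d < k.choose 4 := by
    decide +kernel
  exact this k (by omega) d hdk c hcd b hbc a hab

section

variable {O : ℕ → ℕ → ℕ → ℕ → Bool} {m N : ℕ}

theorem Codes.digit_cons (h : Codes O m N) {a b c d : ℕ} (hab : a < b) (hbc : b < c) (hcd : c < d)
    (hd : d < 8) (hm : pos a b c d = m) :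
    Codes O (m + 1) (N + (digit O a b c d) <<< (3 * m)) := by
  have hdig : digit O a b c d < 8 := by
    unfold digit
    cases O a b c d <;> cases O b a c d <;> cases O c a b d <;> simp
  have hpow : 0 < 2 ^ (3 * m) := by positivity
  rw [Nat.shiftLeft_eq]
  have hN := h.1
  constructor
  · rw [mul_add, pow_add]
    have := Nat.mul_le_mul_right (2 ^ (3 * m)) (Nat.lt_succ_iff.1 hdig)
    omega
  · intro a' b' c' d' hab' hbc' hcd' hd' hm'
    rw [octal_eq]
    rcases Nat.lt_succ_iff_lt_or_eq.1 hm' with hlt | heq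
    · rw [← h.2 a' b' c' d' hab' hbc' hcd' hd' hlt, octal_eq]
      obtain ⟨n, rfl⟩ := Nat.exists_eq_add_of_lt hlt
      rw [show 3 * (pos a' b' c' d' + n + 1) = 3 * pos a' b' c' d' + (3 * n + 3) by ring, pow_add,
        mul_left_comm, Nat.add_mul_div_left _ _ (by positivity), pow_add, ← mul_assoc,
        show 2 ^ 3 = 8 from rfl, Nat.add_mul_mod_self_right]
    · have := quad_pos hab hbc hcd hd
      rw [hm, ← heq, quad_pos hab' hbc' hcd' hd'] at this
      simp only [Prod.mk.injEq] at this
      obtain ⟨rfl, rfl, rfl, rfl⟩ := this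
      rw [heq, Nat.add_mul_div_right _ _ hpow, Nat.div_eq_of_lt hN, zero_add, Nat.mod_eq_of_lt hdig]

theorem bitAt_digit (O : ℕ → ℕ → ℕ → ℕ → Bool) (a b c d : ℕ) :
    bitAt (digit O a b c d) 0 = O a b c d ∧ bitAt (digit O a b c d) 1 = O b a c d ∧
      bitAt (digit O a b c d) 2 = O c a b d := by
  unfold digit
  generalize O a b c d = x, O b a c d = y, O c a b d = z
  revert x y z
  decide

theorem Codes.decodeSorted_eq (hO : IsTwistedSystem O) {k : ℕ} (hk : k ≤ 8)
    (h : Codes O (k.choose 4) N) {v b c d : ℕ} (hv : v < k) (hbc : b < c) (hcd : c < d) (hd : d < k)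
    (hvb : v ≠ b) (hvc : v ≠ c) (hvd : v ≠ d) : decodeSorted N v b c d = O v b c d := by
  have hquad {x y z t : ℕ} (hxy : x < y) (hyz : y < z) (hzt : z < t) (ht : t < k) :
      quadDigit N x y z t = digit O x y z t :=
    h.2 x y z t hxy hyz hzt (by omega) (pos_lt_choose hxy hyz hzt ht hk)
  simp only [decodeSorted, Bool.cond_eq_ite, Nat.blt_eq]
  split_ifs with h₁ h₂ h₃
  · rw [hquad h₁ hbc hcd hd]
    exact (bitAt_digit O _ _ _ _).1
  · rw [hquad (by omega) h₂ hcd hd]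
    exact (bitAt_digit O _ _ _ _).2.1
  · rw [hquad hbc (by omega) h₃ hd]
    exact (bitAt_digit O _ _ _ _).2.2
  · have hdv : d < v := by omega
    rw [hquad hbc hcd hdv hv, (bitAt_digit O _ _ _ _).1, (bitAt_digit O _ _ _ _).2.1,
      (bitAt_digit O _ _ _ _).2.2, hO.parity hbc hcd hdv (by omega)]

theorem Codes.decode_eq (hO : IsTwistedSystem O) {k : ℕ} (hk : k ≤ 8)
    (h : Codes O (k.choose 4) N) {v b c d : ℕ} (hv : v < k) (hb : b < k) (hc : c < k) (hd : d < k)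
    (hn : [v, b, c, d].Nodup) : decode N v b c d = O v b c d := by
  have hne : v ≠ b ∧ v ≠ c ∧ v ≠ d ∧ b ≠ c ∧ b ≠ d ∧ c ≠ d := by
    simp at hn
    tauto
  obtain ⟨hvb, hvc, hvd, hbc, hbd, hcd⟩ := hne
  have rotate {b c d : ℕ} (hb : b < k) (hc : c < k) (hd : d < k) (hn : [v, b, c, d].Nodup) :=
    hO.isOrientationOn.rotate v (hv.trans_le hk) b (hb.trans_le hk) c (hc.trans_le hk) d
      (hd.trans_le hk) hn
  have swap {b c d : ℕ} (hb : b < k) (hc : c < k) (hd : d < k) (hn : [v, b, c, d].Nodup) :=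
    hO.isOrientationOn.swap v (hv.trans_le hk) b (hb.trans_le hk) c (hc.trans_le hk) d
      (hd.trans_le hk) hn
  have sorted {b c d : ℕ} (hbc : b < c) (hcd : c < d) (hd : d < k) (hvb : v ≠ b) (hvc : v ≠ c)
      (hvd : v ≠ d) := h.decodeSorted_eq hO hk hv hbc hcd hd hvb hvc hvd
  simp only [decode, Bool.cond_eq_ite, Nat.blt_eq]
  split_ifs with h₁ h₂ h₃ h₂ h₃
  · exact sorted h₁ h₂ hd hvb hvc hvd
  · rw [sorted h₃ (by omega) hc hvb hvd hvc, swap hb hc hd hn, Bool.not_not]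
  · rw [sorted (by omega) h₁ hc hvd hvb hvc,
      ← rotate hd hb hc (by simp; omega)]
  · rw [sorted (by omega) h₂ hd hvc hvb hvd, ← swap hc hb hd (by simp; omega),
      rotate hb hc hd hn]
  · rw [sorted h₃ (by omega) hb hvc hvd hvb, rotate hb hc hd hn]
  · rw [sorted (by omega) (by omega) hb hvd hvc hvb, rotate hb hd hc (by simp; omega),
      swap hb hc hd hn, Bool.not_not]

theorem Codes.of_certifies (hO : IsTwistedSystem O) {k : ℕ} (hk : k < 8) {reps : List ℕ} {c : ℕ}
    (h : Codes O ((k + 1).choose 4) N)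
    (hc : certifies k ((k + 1).choose 4) reps N c = true) :
    ∃ p f, PermutesBelow p ∧ ∃ R ∈ reps, Codes (transport O p f) ((k + 1).choose 4) R := by
  simp only [certifies, isTransport, Bool.and_eq_true, List.all_eq_true, List.mem_range,
    Nat.beq_eq, Bool.not_eq_true', Nat.blt_eq, Nat.ble_eq, Option.any_eq_true] at hc
  obtain ⟨-, R, hR, ⟨⟨⟨hlt, hdig⟩, hinj⟩, hmaps⟩, hle⟩ := hc
  set p := octal c
  have hinj : Set.InjOn p (Set.Iio 8) := by
    have hne : ∀ x < 8, ∀ y < x, p x ≠ p y := fun x hx y hy h => by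
      simpa [h] using hinj x hx y hy
    intro x hx y hy hxy
    rcases lt_trichotomy x y with hlt | heq | hlt
    · exact absurd hxy.symm (hne y hy x hlt)
    · exact heq
    · exact absurd hxy (hne x hx y hlt)
  refine ⟨p, c.testBit 24, ⟨hmaps, hinj⟩, R, List.mem_of_getElem? hR, ?_, ?_⟩
  · rw [Nat.shiftRight_eq_div_pow] at hlt
    exact (Nat.div_eq_zero_iff.1 hlt).resolve_left (by positivity)
  · intro a b c' d hab hbc hcd hd hm
    have hd' : d ≤ k := by
      by_contra hdk
      have : ∀ d < 8, ∀ k < d, ∀ c < d, ∀ b < c, ∀ a < b,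
          (k + 1).choose 4 ≤ pos a b c d := by
        decide +kernel
      exact (this d hd k (not_le.1 hdk) c' hcd b hbc a hab).not_gt hm
    have := hdig _ hm
    rw [quad_pos hab hbc hcd hd] at this
    rw [← this]
    have decode_eq {v b c d : ℕ} (hv : v ≤ k) (hb : b ≤ k) (hc : c ≤ k) (hd : d ≤ k)
        (hn : [v, b, c, d].Nodup) : decode N (p v) (p b) (p c) (p d) = O (p v) (p b) (p c) (p d) :=
      h.decode_eq hO hk (Nat.lt_succ_iff.2 (hle v (Nat.lt_succ_iff.2 hv)))
        (Nat.lt_succ_iff.2 (hle b (Nat.lt_succ_iff.2 hb)))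
        (Nat.lt_succ_iff.2 (hle c (Nat.lt_succ_iff.2 hc)))
        (Nat.lt_succ_iff.2 (hle d (Nat.lt_succ_iff.2 hd))) (by
        refine List.Nodup.map_on (f := p) (l := [v, b, c, d]) (fun x hx y hy => hinj ?_ ?_) hn
        · simp at hx ⊢
          omega
        · simp at hy ⊢
          omega)
    have hn := nodup_of_lt hab hbc hcd
    simp only [digit, transport]
    rw [decode_eq (by omega) (by omega) (by omega) hd' hn,
      decode_eq (by omega) (by omega) (by omega) hd' (by simp; omega),
      decode_eq (by omega) (by omega) (by omega) hd' (by simp; omega)]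

end

/-! ### Correctness of the search -/

theorem testBit_bitSet (l : List ℕ) (i : ℕ) : (bitSet l).testBit i = decide (i ∈ l) := by
  induction l with
  | nil => simp [bitSet]
  | cons j l ih =>
    change (bitSet l ||| 1 <<< j).testBit i = _
    rw [Nat.testBit_or, ih, Nat.one_shiftLeft, Nat.testBit_two_pow]
    by_cases h : j = i
    · simp [h]
    · simp [h, Ne.symm h]

theorem testBit_allowed {N s : ℕ} (hs : (255).testBit s = true) (l : List (ℕ × List ℕ))
    (h : ∀ c ∈ l, (c.1 >>> (8 * lookup N c.2)).testBit s = true) :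
    (allowed N l).testBit s = true := by
  induction l with
  | nil => exact hs
  | cons c l ih =>
    change (allowed N l &&& (c.1 >>> (8 * lookup N c.2))).testBit s = true
    rw [Nat.testBit_and, ih fun c hc => h c (List.mem_cons_of_mem _ hc), h c List.mem_cons_self]
    rfl

theorem search_cons {leaf : ℕ → Bool} {p : ℕ × List (ℕ × List ℕ)} {l : List (ℕ × List (ℕ × List ℕ))}
    {N s : ℕ} (h : search leaf (p :: l) N = true) (hs : s ∈ [0, 1, 3, 4, 6, 7])
    (hp : (allowed N p.2).testBit s = true) : search leaf l (N + s <<< (3 * p.1)) = true := by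
  have key : ∀ (F : ℕ → Bool) (m : ℕ) (l : List ℕ), s ∈ l → m.testBit s = true →
      (List.rec true (fun s _ rest => Bool.rec false rest
        (Nat.rec true (fun _ _ => F s) ((m >>> s) &&& 1))) l : Bool) = true → F s = true := by
    intro F m l hsl hms h
    induction l with
    | nil => simp at hsl
    | cons t l ih =>
      change (Bool.rec false _ (Nat.rec true (fun _ _ => F t) ((m >>> t) &&& 1) : Bool) : Bool) =
        true at h
      rcases List.mem_cons.1 hsl with rfl | hsl
      · have : (m >>> s) &&& 1 = 1 := by
          rw [Nat.and_one_is_mod, Nat.shiftRight_eq_div_pow]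
          simpa [Nat.testBit_eq_decide_div_mod_eq] using hms
        rw [this] at h
        change (Bool.rec false _ (F s) : Bool) = true at h
        cases hF : F s
        · rw [hF] at h
          exact h
        · rfl
      · refine ih hsl ?_
        generalize (Nat.rec true (fun _ _ => F t) ((m >>> t) &&& 1) : Bool) = b at h
        cases b
        · exact absurd h Bool.false_ne_true
        · exact h
  exact key (fun s => search leaf l (N + s <<< (3 * p.1))) _ _ hs hp h

theorem pos_pairwise {w x y z d : ℕ} (hwx : w < x) (hxy : x < y) (hyz : y < z) (hzd : z < d)
    (hd : d < 8) :
    [pos w x y z, pos w x y d, pos w x z d, pos w y z d, pos x y z d].Pairwise (· < ·) := by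
  have : ∀ d < 8, ∀ z < d, ∀ y < z, ∀ x < y, ∀ w < x,
      decide ([pos w x y z, pos w x y d, pos w x z d, pos w y z d, pos x y z d].Pairwise
        (· < ·)) = true := by
    decide +kernel
  exact of_decide_eq_true (this d hd z hzd y hyz x hxy w hwx)

section

variable {O : ℕ → ℕ → ℕ → ℕ → Bool} {N : ℕ}

theorem IsTwistedSystem.testBit_constraint (hO : IsTwistedSystem O) {x y z d w : ℕ} (hxy : x < y)
    (hyz : y < z) (hzd : z < d) (hd : d < 8) (h : Codes O (pos x y z d) N) (hw : w < d) :
    ((constraint x y z d w).1 >>> (8 * lookup N (constraint x y z d w).2)).testBit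
      (digit O x y z d) = true := by
  have h255 : (255 : ℕ).testBit (digit O x y z d) = true := by
    have : ∀ s ∈ [0, 1, 3, 4, 6, 7], (255 : ℕ).testBit s = true := by decide
    exact this _ (hO.digit_mem hxy hyz hzd hd)
  have lookup_cons (i : ℕ) (l : List ℕ) : lookup N (i :: l) = octal N i + 8 * lookup N l := rfl
  have lookup_nil : lookup N [] = 0 := rfl
  simp only [constraint, Bool.cond_eq_ite, Nat.blt_eq, Nat.beq_eq]
  rw [Nat.testBit_shiftRight]
  split_ifs with h₁ h₂ h₃ h₄ h₅ h₆
  · have l := pos_pairwise h₁ hxy hyz hzd hd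
    simp at l
    simp only [lookup_cons, lookup_nil, h.2 w x y z h₁ hxy hyz (by omega) (by omega),
      h.2 w x y d h₁ hxy (by omega) hd (by omega), h.2 w x z d h₁ (by omega) hzd hd (by omega),
      h.2 w y z d (by omega) hyz hzd hd (by omega), prefixes5, testBit_bitSet, decide_eq_true_eq]
    refine List.mem_map.2 ⟨_, hO.digits5_mem h₁ hxy hyz hzd hd, ?_⟩
    simp only [digits5]
    ring
  · simpa [lookup_nil] using h255
  · have h₁ : x < w := by omega
    have l := pos_pairwise h₁ h₃ hyz hzd hd
    simp at l
    simp only [lookup_cons, lookup_nil, h.2 x w y z h₁ h₃ hyz (by omega) (by omega),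
      h.2 x w y d h₁ h₃ (by omega) hd (by omega), h.2 x w z d h₁ (by omega) hzd hd (by omega),
      prefixes4, testBit_bitSet, decide_eq_true_eq]
    refine List.mem_map.2 ⟨_, hO.digits5_mem h₁ h₃ hyz hzd hd, ?_⟩
    simp only [digits5]
    ring
  · simpa [lookup_nil] using h255
  · have h₁ : y < w := by omega
    have l := pos_pairwise hxy h₁ h₅ hzd hd
    simp at l
    simp only [lookup_cons, lookup_nil, h.2 x y w z hxy h₁ h₅ (by omega) (by omega),
      h.2 x y w d hxy h₁ (by omega) hd (by omega), prefixes3, testBit_bitSet, decide_eq_true_eq]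
    refine List.mem_map.2 ⟨_, hO.digits5_mem hxy h₁ h₅ hzd hd, ?_⟩
    simp only [digits5]
    ring
  · simpa [lookup_nil] using h255
  · have h₁ : z < w := by omega
    have l := pos_pairwise hxy hyz h₁ hw hd
    simp at l
    simp only [lookup_cons, lookup_nil, h.2 x y z w hxy hyz h₁ (by omega) (by omega),
      prefixes2, testBit_bitSet, decide_eq_true_eq]
    refine List.mem_map.2 ⟨_, hO.digits5_mem hxy hyz h₁ hw hd, ?_⟩
    simp only [digits5]
    ring

theorem Codes.exists_of_search (hO : IsTwistedSystem O) {leaf : ℕ → Bool}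
    (l : List (ℕ × List (ℕ × List ℕ))) {i : ℕ} (hpos : l.map Prod.fst = List.range' i l.length)
    (hl : ∀ p ∈ l, ∃ x y z d, x < y ∧ y < z ∧ z < d ∧ d < 8 ∧
      p = (pos x y z d, (List.range d).map (constraint x y z d)))
    (h : Codes O i N) (hs : search leaf l N = true) :
    ∃ N', Codes O (i + l.length) N' ∧ leaf N' = true := by
  induction l generalizing i N with
  | nil => exact ⟨N, h, hs⟩
  | cons p l ih =>
    obtain ⟨x, y, z, d, hxy, hyz, hzd, hd, hp⟩ := hl p List.mem_cons_self
    rw [List.map_cons, List.length_cons, List.range'_succ, List.cons.injEq] at hpos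
    have hi : pos x y z d = i := by
      rw [← hpos.1, hp]
    have hdig := hO.digit_mem hxy hyz hzd hd
    have hall : (allowed N p.2).testBit (digit O x y z d) = true := by
      refine testBit_allowed ?_ _ fun c hc => ?_
      · have : ∀ s ∈ [0, 1, 3, 4, 6, 7], (255 : ℕ).testBit s = true := by decide
        exact this _ hdig
      · rw [hp] at hc
        obtain ⟨w, hw, rfl⟩ := List.mem_map.1 hc
        exact hO.testBit_constraint hxy hyz hzd hd (hi ▸ h) (List.mem_range.1 hw)
    have := search_cons hs hdig hall
    rw [hpos.1] at this
    obtain ⟨N', hN', hleaf⟩ := ih hpos.2 (fun p hp => hl p (List.mem_cons_of_mem _ hp))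
      (h.digit_cons hxy hyz hzd hd hi) this
    exact ⟨N', by rwa [List.length_cons, add_comm l.length, ← add_assoc], hleaf⟩

/-- Some relabelling of `O` has one of the codes in `reps` on the numbers below `k`. -/
def HasCodeIn (O : ℕ → ℕ → ℕ → ℕ → Bool) (k : ℕ) (reps : List ℕ) : Prop :=
  ∃ p f, PermutesBelow p ∧ ∃ R ∈ reps, Codes (transport O p f) (k.choose 4) R

theorem HasCodeIn.succ (hO : IsTwistedSystem O) {k : ℕ} (hk : k < 8) {reps reps' : List ℕ}
    {certs : List (List ℕ)} (hlen : reps.length = certs.length)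
    (hcov : extensionsCovered k reps reps' certs = true) (h : HasCodeIn O k reps) :
    HasCodeIn O (k + 1) reps' := by
  obtain ⟨p, f, hp, R, hR, hcode⟩ := h
  obtain ⟨i, hi, rfl⟩ := List.getElem_of_mem hR
  have hmem : (reps[i], certs[i]) ∈ reps.zip certs := by
    rw [← List.getElem_zip (h := by rw [List.length_zip]; omega)]
    exact List.getElem_mem _
  have hsearch := List.all_eq_true.1 hcov _ hmem
  have hplan : ∀ k < 8, (plan k).map Prod.fst = List.range' (k.choose 4) (plan k).length ∧
      k.choose 4 + (plan k).length = (k + 1).choose 4 := by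
    decide +kernel
  obtain ⟨N, hN, hleaf⟩ := hcode.exists_of_search (hO.transport hp f) (plan k) (hplan k hk).1
    (fun q hq => by
      simp only [plan, List.mem_flatMap, List.mem_map, List.mem_range] at hq
      obtain ⟨z, hz, y, hy, x, hx, rfl⟩ := hq
      exact ⟨x, y, z, k, hx, hy, hz, hk, rfl⟩) hsearch
  rw [(hplan k hk).2] at hN
  obtain ⟨c, -, hc⟩ := List.any_eq_true.1 hleaf
  obtain ⟨p', f', hp', R', hR', hcode'⟩ := hN.of_certifies (hO.transport hp f) hk hc
  refine ⟨p ∘ p', f ^^ f', ⟨hp.1.comp hp'.1, hp.2.comp hp'.2 hp'.1⟩, R', hR', ?_⟩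
  have : transport O (p ∘ p') (f ^^ f') = transport (transport O p f) p' f' := by
    funext v b c d
    simp [transport]
  rwa [this]

end

def reps6 : List ℕ := [
    15078613071579, 8795151415003, 8795285927643, 4883941537499]

def reps7 : List ℕ := [
    357233969109201580105685546715, 39692828741672074389309372123,
    6241516579888035725568848705243, 6330825181454497333749871556315,
    6241516617667112020373435070171, 6320902016095789985674014242523,
    40475510426285941841345768339163, 40475510464065018136150354704091,
    40296893559116962608780480100059]

def reps8 : List ℕ := [
    940260065381255807041911022662364775076762460176307995979822811,
    1410389876954776649530156307302926158977164473544886324857681627,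
    938652734240105035462440490521616633928910552705434923024004827,
    1407979076791496016712905467009896154000225689444300257880979163,
    7840246960531424426296624751714083886997312375923593459419,
    7837181969446838142305553857771089492760502018523803956955,
    7726623322380216915568907079349139991017897399440713463515,
    7824897685721225214478304754108522190586819018178661725915,
    940259672284363659637973125507846196462466613036890401879897819,
    1410389483857884502126218410148407580362868626405468730757756635,
    2418247313349016837739239763263140446529934273544396470236891,
    2418244248357932251455248692369197452135697463186996680734427,
    706600677590087504232322922909161998985296270985114304752137947,
    78482186012175176481374215997599709470810710237015282038491,
    940287986793534119155834458712312058278878868941827548257466075,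
    28253087845367558117152784410868528573099600051807411255003,
    706600677590134272284761068112028979869246718172101493982770907,
    937085878748392432142077311947770825138451397019351001046464219,
    705696553823224653464232949991441746600232752685732063174735579,
    1645052495437337928114636077174729101886524046864703549532550875,
    1645504446762332434216263106877738981032774202594862101306554075,
    1645102712251267778172510616560079151384070031478875601491736283,
    935730024773548909097088781432358058501174854704954950614529755,
    704340699848381130419244419476028979962956210371336012742801115,
    28253087985671715300919464558422272551641846233581521745627,
    937085878748532736299261078627918378882429939265532775156954843,
    706600677590126973340017013523747018819341825229731610146911963,
    706600677590173741392455158726613999703292272416718799377544923,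
    705696553823264122571927040606026766434278306930349368569509595,
    28253088025140822995010079143442106597196090850886916519643,
    1624855361691394565775904071834163928065608756166354164057650907,
    236470644899779678133564371960276493640532475790260630565435099]

def certs5 : List (List ℕ) := [
   [253419505288, 326450697409, 2551260563080, 2366560031843, 665736328261, 1417389101148,
    2263464182428, 1419570235016, 2151862141596, 859043350344, 1410929928897, 1529041528641,
    1939261146757, 2641454779080, 702310613676, 289993753253, 2428853901512, 77325669612,
    2650011079909, 2212025255560, 2345169147425, 118144639843, 498299618984, 813929343587,
    1922014262376, 2673666999976]]

def certs6 : List (List ℕ) := [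
   [2574849328776, 1376553223816, 2364429485704, 1166133380744, 210518455724, 616411350664,
    2448248456840, 1215557977734, 1127579567752, 1962984261256, 1104006014730, 2637225969544,
    423119338668, 702292223660, 2237827303046, 1821182184648, 1335934237962, 1930787207562,
    2697355520200, 1322898433845, 1501240411824, 2336645105328, 249190336176],
   [186947946120, 607821186696, 244861654246, 2227106374861, 2609225263745, 1013830043272,
    844127824474, 1679549744776, 721587133569, 1638696770650, 1198345038406, 1769642276166,
    1612976939100, 1127544980316, 358712279900, 1524964705928, 15283585884, 910565692801,
    1548553111432, 2119732178125, 212783740230, 1960818386829, 2635212441222, 1260857771656,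
    294422662344, 2594410660724, 953733153638, 1720351811784, 530544597684, 1956473739942,
    1913591175846, 1898625550000, 803274634608, 857012720538, 646609028784],
   [1026681161352, 1651565348488, 485430027469, 2723260352136, 2478278607772, 2656604213786,
    1282130239580, 2171306463770, 2364662793905, 1402574236250, 2237961291433, 204278357082,
    1059009881869, 2592263718792, 378055830733, 219142039437, 2304517558810, 1338133269704,
    852851577395, 1997460427299, 2764062419144, 163476165530, 2738324857692, 1696594562140],
   []]

def certs7 : List (List ℕ) := [
   [2254874265224, 384449562248, 2684402714248, 2643566970504, 2379495425672, 2768188130952,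
    2037976123016, 1082379454088, 2720978880136, 2076767340168, 2660780746549, 476856985397,
    960109397640, 2542656530229, 1284412982920, 1243407984437, 1675119306549, 784082847368,
    393132388085, 2596481451976, 921410652104, 2291505221320, 2493230851893, 1733193027272,
    2252853225461, 1249984653109, 2351668328648, 234325550901, 788342777653, 1550487136053,
    1982198458165, 83789358901],
   [116079380104, 2130385028744, 1299342411400, 1898660415112, 28235712136, 2328188864136,
    2287353120392, 1681762272904, 726165603976, 2169310463624, 1052652521096, 1808538241262,
    876329011438, 485584500490, 2689024575432, 1013953775560, 2384048344776, 2585775490695,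
    1825736150728, 2345305325322, 1342430460362, 2444211452104, 1643030169272, 2115629779182,
    1183420549358, 1142700033720],
   [1456107431741, 1503284963133, 2686548453167, 2725442434540, 1862287410824, 1690522273416,
    2122131097224, 2418517395080, 1608951449224, 1744163227271, 103598966408, 445082420872,
    758648587912, 176569370568, 1286628392620, 53972793004, 1694905321095, 2249035794056,
    2281103347400, 15610859144, 1005600831624, 2107157182664, 2774863718205, 752159999672,
    1946069419704, 2070580741816],
   [2117601248904, 515577988744, 2433212491567, 1544424441480, 2727687472776, 1131967440111,
    2471838037484, 653319390856, 1172754705891, 1095870629512, 1355714315912, 1174902189987,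
    535206217351, 2021469636232, 1089495287432, 505413289608, 25998456227, 2708627703752,
    1033023995564, 391206991532, 2585654687404, 486006244999, 1995800495752, 2027875389128,
    2547661852296, 752365533320, 1853929224392, 651065320701, 2328547215032, 1396572866232,
    861623731896],
   [528360941373, 1084492097341, 1999523202696, 2267755587375, 397499942536, 870087854319,
    2306716677612, 1703506003592, 1490871568008, 1190391629448, 1325446645383, 1879562743900,
    2302708205241, 2470427936392, 1514739770935, 116570113713, 73834350216, 1903434311230,
    1014386050737, 340157712008, 2543305017288, 867902635692, 2420533327532, 1830474401415,
    1862552702664, 2382406274696, 587109955720, 1688606537928, 2356070852413, 2485456914104,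
    2609798366863, 1018423592632],
   [734688888456, 1917951919752, 1559153092399, 161216923887, 1344480413949, 1900880005373,
    1597845747180, 481755580040, 638576150201, 2491945494078, 2659180783159, 305807140407,
    262589031998, 2416712021774, 1834668967880, 159031705260, 1711662397100, 1121750001614,
    1153916653256, 1673682665230, 2663672625614, 979970488520, 1776734348814, 945666311823,
    2674214741518, 13750937102],
   [1793800521352, 1840875554440, 659694274184, 1772049689255, 1241560405223, 698754692341,
    629369077057, 1726594100195, 1284221271361, 2199912105608, 2028055854165, 2459755792008,
    2418092633921, 2756052807253, 1037541727303, 536896957377, 2367413536392, 2302119718755,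
    1048344144775, 277666739527, 2081789800540, 2601245967260, 861621945244, 440642536348,
    782606452360, 655903851420, 1928603956579, 869748143459, 73900836808, 1184085978869,
    1065860347207, 2305112036814, 1463258851317, 2032429352583, 2586526271112, 469106328476,
    904977010376, 1424694608828, 2010957644711, 327303919816, 249752460668, 2457365650791,
    1310676491623, 1089684031160, 604084254072, 1942184025562, 2283606402005, 2408205436600],
   [866154694280, 1422319404680, 241069180552, 822767539431, 279804277966, 1307868343267,
    2041030035080, 1827916940252, 1948687779464, 1883393961827, 1662983856661, 2216611508316,
    2182594921308, 442965394268, 2640198682297, 22464349832, 454060590769, 411157055112,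
    237246269064, 451022386531, 2440461371336, 765135564494, 1886084289998, 1044308436942,
    2167797106311, 50448746120, 486251253448, 1006037028488, 1592300075144, 2693864454344,
    37493327544, 162002552463, 1355470540380],
   [1869096666760, 728615077512, 767207044301, 256503350236, 2092212714074, 2436200121992,
    1160594031452, 1536014442074, 138391777372, 520547980186, 1040167175004, 2085823939420,
    1624552425096, 724756661084, 142687422408, 1252538330829, 1531711203277, 89100043911,
    537895621530, 1671766954970, 973763595976, 1493554758524, 2079817794407, 396090505416,
    402443708301, 1931641013944, 1037798233050, 464809266780]]

theorem extensionsCovered_five :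
    extensionsCovered 5 [14043] reps6 certs5 = true := by
  decide +kernel

theorem extensionsCovered_six :
    extensionsCovered 6 reps6 reps7 certs6 = true := by
  decide +kernel

theorem extensionsCovered_seven :
    extensionsCovered 7 reps7 reps8 certs7 = true := by
  decide +kernel

theorem HasCodeIn.five {O : ℕ → ℕ → ℕ → ℕ → Bool} (hO : IsTwistedSystem O) :
    HasCodeIn O 5 [14043] := by
  obtain ⟨q, f, h⟩ := hO (fun i => i) Fin.val_injective fun i => by omega
  set p : ℕ → ℕ := fun i => if hi : i < 5 then q.symm ⟨i, hi⟩ else i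
  have hval (i : Fin 5) : p i = q.symm i := by simp [p]
  have hp (i : ℕ) (hi : i < 5) : p i < 5 := by simp [p, hi]
  refine ⟨p, f, ⟨fun i hi => ?_, fun i hi j hj hij => ?_⟩, 14043, by simp, by decide, ?_⟩
  · by_cases h5 : i < 5
    · exact (hp i h5).trans (by decide)
    · simpa [p, h5] using hi
  · by_cases hi5 : i < 5 <;> by_cases hj5 : j < 5
    · have : q.symm ⟨i, hi5⟩ = q.symm ⟨j, hj5⟩ := Fin.ext (by simpa [p, hi5, hj5] using hij)
      simpa using q.symm.injective this
    · have := hp i hi5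
      simp only [hij, p, hj5, dite_false] at this
    · have := hp j hj5
      simp only [← hij, p, hi5, dite_false] at this
    · simpa [p, hi5, hj5] using hij
  · have relabel_eq (i j k l : Fin 5) (hn : [i, j, k, l].Nodup) :
        transport O p f i j k l = twistedOrient i j k l := by
      have := h (q.symm i) (q.symm j) (q.symm k) (q.symm l)
        (List.Nodup.map (l := [i, j, k, l]) q.symm.injective hn)
      simp only [transport, hval, this, Equiv.apply_symm_apply, Bool.xor_assoc, Bool.xor_self,
        Bool.xor_false]
    have digits : ∀ a b c d : Fin 5, a < b → b < c → c < d →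
        octal 14043 (pos a b c d) = digit twistedOrient a b c d := by decide +kernel
    intro a b c d hab hbc hcd hd hm
    have hd5 : d < 5 := by
      by_contra hd5
      have : ∀ d < 8, ∀ c < d, ∀ b < c, ∀ a < b, 5 ≤ d → 5 ≤ pos a b c d := by decide +kernel
      exact (this d hd c hcd b hbc a hab (not_lt.1 hd5)).not_gt hm
    have := digits ⟨a, by omega⟩ ⟨b, by omega⟩ ⟨c, by omega⟩ ⟨d, hd5⟩ hab hbc hcd
    rw [this]
    have hn : [(⟨a, by omega⟩ : Fin 5), ⟨b, by omega⟩, ⟨c, by omega⟩, ⟨d, hd5⟩].Nodup := by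
      simp
      omega
    rw [digit, digit, ← relabel_eq _ _ _ _ hn, ← relabel_eq _ _ _ _ (by grind),
      ← relabel_eq _ _ _ _ (by grind)]

theorem GenTwisted.exists_decode_eq {P : PreRotSys (Fin 8)} (hP : GenTwisted P) :
    ∃ (e : Equiv.Perm (Fin 8)) (f : Bool), ∃ R ∈ reps8, ∀ v b c d : Fin 8, [v, b, c, d].Nodup →
      decode R v b c d = (P.orient (e v) (e b) (e c) (e d) ^^ f) := by
  let O (v b c d : ℕ) : Bool :=
    P.orient (Fin.ofNat 8 v) (Fin.ofNat 8 b) (Fin.ofNat 8 c) (Fin.ofNat 8 d)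
  have ofNat_inj {i j : ℕ} (hi : i < 8) (hj : j < 8) (h : Fin.ofNat 8 i = Fin.ofNat 8 j) :
      i = j := by
    simpa [Fin.ext_iff, Nat.mod_eq_of_lt hi, Nat.mod_eq_of_lt hj] using h
  have hO : IsTwistedSystem O := fun w hw hw8 =>
    hP.isTwistedOn (w := fun i => Fin.ofNat 8 (w i))
      fun i j hij => hw (ofNat_inj (hw8 i) (hw8 j) hij)
  have h8 : HasCodeIn O 8 reps8 := (((HasCodeIn.five hO).succ hO (by decide) rfl
    extensionsCovered_five).succ hO (by decide) rfl extensionsCovered_six).succ hO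
    (by decide) rfl extensionsCovered_seven
  obtain ⟨p, f, hp, R, hR, hcode⟩ := h8
  have hinj : Function.Injective fun i : Fin 8 => Fin.ofNat 8 (p i) := fun i j hij =>
    Fin.ext (hp.2 i.2 j.2 (ofNat_inj (hp.1 i.2) (hp.1 j.2) hij))
  refine ⟨Equiv.ofBijective _ (Finite.injective_iff_bijective.1 hinj), f, R, hR,
    fun v b c d hn => ?_⟩
  exact hcode.decode_eq (hO.transport hp f) le_rfl v.2 b.2 c.2 d.2
    (List.Nodup.map (l := [v, b, c, d]) Fin.val_injective hn)

/-! ### The representatives are realized -/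

theorem decode_of_lt (N v : ℕ) {b c d : ℕ} (hbc : b < c) (hcd : c < d) :
    decode N v b c d = decodeSorted N v b c d := by
  simp [decode, Bool.cond_eq_ite, Nat.blt_eq, hbc, hcd]

theorem isOrientationOn_decode (N : ℕ) (s : Set ℕ) : IsOrientationOn (decode N) s where
  rotate v _ b _ c _ d _ hn := by
    have hne : b ≠ c ∧ b ≠ d ∧ c ≠ d := by simp at hn; tauto
    simp only [decode, Bool.cond_eq_ite, Nat.blt_eq]
    split_ifs <;> first | omega | rfl
  swap v _ b _ c _ d _ hn := by
    have hne : b ≠ c ∧ b ≠ d ∧ c ≠ d := by simp at hn; tauto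
    simp only [decode, Bool.cond_eq_ite, Nat.blt_eq]
    split_ifs <;> first | omega | simp

/-- An orientation function on five elements, with the parity property of twisted systems, is
determined by its digits. -/
theorem eq_of_digits5_eq {X Y : Fin 5 → Fin 5 → Fin 5 → Fin 5 → Bool}
    (hX : IsOrientationOn X Set.univ) (hY : IsOrientationOn Y Set.univ)
    (h : ∀ i j k l, i < j ∧ j < k ∧ k < l → X i j k l = Y i j k l ∧ X j i k l = Y j i k l ∧
      X k i j l = Y k i j l ∧ X l i j k = Y l i j k)
    {i j k l : Fin 5} (hn : [i, j, k, l].Nodup) : X i j k l = Y i j k l := by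
  refine hX.eq_of_increasing hY trivial ?_ trivial trivial trivial hn
  intro b _ c _ d _ hn hbc hcd
  have hv : i ≠ b ∧ i ≠ c ∧ i ≠ d := by simp at hn; tauto
  rcases lt_or_gt_of_ne hv.1 with h₁ | h₁
  · exact (h _ _ _ _ ⟨h₁, hbc, hcd⟩).1
  rcases lt_or_gt_of_ne hv.2.1 with h₂ | h₂
  · exact (h _ _ _ _ ⟨h₁, h₂, hcd⟩).2.1
  rcases lt_or_gt_of_ne hv.2.2 with h₃ | h₃
  · exact (h _ _ _ _ ⟨hbc, h₂, h₃⟩).2.2.1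
  · exact (h _ _ _ _ ⟨hbc, hcd, h₃⟩).2.2.2

theorem digit_decode {R a b c d : ℕ} (hab : a < b) (hbc : b < c) (hcd : c < d) :
    digit (decode R) a b c d = quadDigit R a b c d := by
  have hlt : quadDigit R a b c d < 8 := by
    rw [quadDigit, octal_eq]
    exact Nat.mod_lt _ (by decide)
  have hdigit : ∀ n < 8, (bitAt n 0).toNat + 2 * (bitAt n 1).toNat + 4 * (bitAt n 2).toNat = n := by
    decide
  rw [digit, decode_of_lt R a hbc hcd, decode_of_lt R b (hab.trans hbc) hcd,
    decode_of_lt R c hab (hbc.trans hcd)]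
  simpa [decodeSorted, Bool.cond_eq_ite, Nat.blt_eq, hab, hbc, hcd, hab.not_gt, hbc.not_gt,
    (hab.trans hbc).not_gt] using
    hdigit _ hlt

theorem decode_parity (R : ℕ) {a b c d : ℕ} (hab : a < b) (hbc : b < c) (hcd : c < d) :
    decode R d a b c = ((decode R a b c d ^^ decode R b a c d) ^^ decode R c a b d) := by
  rw [decode_of_lt R d hab hbc, decode_of_lt R a hbc hcd, decode_of_lt R b (hab.trans hbc) hcd,
    decode_of_lt R c hab (hbc.trans hcd)]
  simp [decodeSorted, Bool.cond_eq_ite, Nat.blt_eq, hab, hbc, hcd, hab.not_gt, hbc.not_gt,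
    hcd.not_gt, (hab.trans hbc).not_gt, (hbc.trans hcd).not_gt, (hab.trans (hbc.trans hcd)).not_gt]

theorem digits5_decode_mem {R : ℕ} (hR : R ∈ reps8) {a b c d e : ℕ} (hab : a < b) (hbc : b < c)
    (hcd : c < d) (hde : d < e) (he : e < 8) : digits5 (decode R) a b c d e ∈ twistedDigits := by
  have check : ∀ R ∈ reps8, ∀ e < 8, ∀ d < e, ∀ c < d, ∀ b < c, ∀ a < b,
      prefixes5.testBit (8 * (quadDigit R a b c d + 8 * quadDigit R a b c e +
        64 * quadDigit R a b d e + 512 * quadDigit R a c d e) + quadDigit R b c d e) = true := by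
    decide +kernel
  have hlt : ∀ s ∈ twistedDigits, s.1 < 8 ∧ s.2.1 < 8 ∧ s.2.2.1 < 8 ∧ s.2.2.2.1 < 8 ∧
      s.2.2.2.2 < 8 := by
    decide +kernel
  have hdlt (a b c d : ℕ) : quadDigit R a b c d < 8 := by
    rw [quadDigit, octal_eq]
    exact Nat.mod_lt _ (by decide)
  have := check R hR e he d hde c hcd b hbc a hab
  rw [prefixes5, testBit_bitSet, decide_eq_true_eq, List.mem_map] at this
  obtain ⟨⟨s₁, s₂, s₃, s₄, s₅⟩, hs, heq⟩ := this
  have hs₈ := hlt _ hs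
  dsimp only at hs₈ heq
  rw [digits5, digit_decode hab hbc hcd, digit_decode hab hbc (hcd.trans hde),
    digit_decode hab (hbc.trans hcd) hde, digit_decode (hab.trans hbc) hcd hde,
    digit_decode hbc hcd hde]
  have := hdlt a b c d
  have := hdlt a b c e
  have := hdlt a b d e
  have := hdlt a c d e
  have := hdlt b c d e
  suffices h : quadDigit R a b c d = s₁ ∧ quadDigit R a b c e = s₂ ∧ quadDigit R a b d e = s₃ ∧
      quadDigit R a c d e = s₄ ∧ quadDigit R b c d e = s₅ by
    rwa [h.1, h.2.1, h.2.2.1, h.2.2.2.1, h.2.2.2.2]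
  omega

theorem isTwistedSystem_decode {R : ℕ} (hR : R ∈ reps8) : IsTwistedSystem (decode R) := by
  intro w hw hw8
  refine IsTwistedOn.of_comp (Tuple.sort w) ?_
  have hmono := (Tuple.monotone_sort w).strictMono_of_injective (hw.comp (Tuple.sort w).injective)
  have h8 (i) : (w ∘ Tuple.sort w) i < 8 := hw8 _
  generalize w ∘ Tuple.sort w = w at hmono h8
  have hlt {i j : Fin 5} (h : i < j) : w i < w j := hmono h
  have hmem := digits5_decode_mem hR (hlt (i := 0) (j := 1) (by decide))
    (hlt (i := 1) (j := 2) (by decide)) (hlt (i := 2) (j := 3) (by decide))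
    (hlt (i := 3) (j := 4) (by decide)) (h8 4)
  obtain ⟨f, -, hmem⟩ := List.mem_flatMap.1 hmem
  obtain ⟨l, hl, hmem⟩ := List.mem_map.1 hmem
  rw [List.mem_permutations'] at hl
  have hlen : l.length = 5 := hl.length_eq
  have hnd : l.Nodup := hl.nodup_iff.2 (by decide)
  have hget (i : Fin 5) : l.getD i 0 = l[(i : ℕ)]'(by omega) :=
    List.getD_eq_getElem _ _ _
  have hl5 (i : Fin 5) : l.getD i 0 < 5 := by
    have : l.getD i 0 ∈ [0, 1, 2, 3, 4] := hl.mem_iff.1 (by rw [hget]; exact List.getElem_mem _)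
    simp only [List.mem_cons, List.not_mem_nil, or_false] at this
    omega
  let p : Equiv.Perm (Fin 5) := Equiv.ofBijective (fun i => ⟨l.getD i 0, hl5 i⟩)
    (Finite.injective_iff_bijective.1 fun i j hij => by
      rw [Fin.mk.injEq, hget, hget] at hij
      exact Fin.ext ((hnd.getElem_inj_iff).1 hij))
  refine ⟨p, f, fun i j k m hn => ?_⟩
  have hwn (i j k l : Fin 5) (hn : [i, j, k, l].Nodup) : [w i, w j, w k, w l].Nodup :=
    List.Nodup.map (l := [i, j, k, l]) hmono.injective hn
  have hdec := isOrientationOn_decode R Set.univ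
  refine eq_of_digits5_eq (X := fun i j k l => decode R (w i) (w j) (w k) (w l))
    ⟨fun i _ j _ k _ l _ hn => hdec.rotate _ trivial _ trivial _ trivial _ trivial (hwn i j k l hn),
      fun i _ j _ k _ l _ hn => hdec.swap _ trivial _ trivial _ trivial _ trivial (hwn i j k l hn)⟩
    (isOrientationOn_twistedOrient p f) ?_ hn
  clear hn i j k m
  intro i j k m hijkm
  have hdigit : digit (transport twistedOrient (fun i => l.getD i 0) f) i j k m =
      digit (decode R) (w i) (w j) (w k) (w m) := by
    simp only [digits5, Prod.mk.injEq] at hmem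
    have : ∀ a b c d : Fin 5, a < b ∧ b < c ∧ c < d → (a, b, c, d) ∈
        [(0, 1, 2, 3), (0, 1, 2, 4), (0, 1, 3, 4), (0, 2, 3, 4), (1, 2, 3, 4)] := by decide
    have := this i j k m hijkm
    simp only [List.mem_cons, Prod.mk.injEq, List.not_mem_nil, or_false] at this
    rcases this with ⟨rfl, rfl, rfl, rfl⟩ | ⟨rfl, rfl, rfl, rfl⟩ | ⟨rfl, rfl, rfl, rfl⟩ |
      ⟨rfl, rfl, rfl, rfl⟩ | ⟨rfl, rfl, rfl, rfl⟩
    exacts [hmem.1, hmem.2.1, hmem.2.2.1, hmem.2.2.2.1, hmem.2.2.2.2]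
  have hbits := bitAt_digit (transport twistedOrient (fun i => l.getD i 0) f) i j k m
  rw [hdigit, (bitAt_digit _ _ _ _ _).1, (bitAt_digit _ _ _ _ _).2.1,
    (bitAt_digit _ _ _ _ _).2.2] at hbits
  have parity : ∀ f : Bool, ∀ x y z t : Fin 5, [x, y, z, t].Nodup → (twistedOrient t x y z ^^ f) =
      (((twistedOrient x y z t ^^ f) ^^ (twistedOrient y x z t ^^ f)) ^^
        (twistedOrient z x y t ^^ f)) := by
    decide +kernel
  have hpar := parity f (p i) (p j) (p k) (p m)
    (List.Nodup.map (l := [i, j, k, m]) p.injective (by simp; omega))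
  refine ⟨hbits.1, hbits.2.1, hbits.2.2, ?_⟩
  rw [hpar, decode_parity R (hlt hijkm.1) (hlt hijkm.2.1) (hlt hijkm.2.2), hbits.1, hbits.2.1,
    hbits.2.2]
  rfl

section

variable {α : Type*} [DecidableEq α]

theorem formPerm_iterate {l : List α} (hl : l.Nodup) {i j : ℕ} (hij : i ≤ j) (hj : j < l.length) :
    l.formPerm^[j - i] l[i] = l[j] := by
  rw [← Equiv.Perm.coe_pow, List.formPerm_pow_apply_getElem _ hl]
  simp only [Nat.add_sub_cancel' hij, Nat.mod_eq_of_lt hj]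

theorem isCyclicPermOn_formPerm {l : List α} (hl : l.Nodup) :
    IsCyclicPermOn l.formPerm l.toFinset := by
  refine ⟨fun a ha => List.formPerm_apply_of_notMem (by simpa using ha), fun a ha b hb => ?_⟩
  rw [List.mem_toFinset] at ha hb
  obtain ⟨i, hi, rfl⟩ := List.getElem_of_mem ha
  obtain ⟨j, hj, rfl⟩ := List.getElem_of_mem hb
  refine ⟨l.length - i + j, ?_⟩
  rw [← Equiv.Perm.coe_pow, List.formPerm_pow_apply_getElem _ hl]
  simp only [show i + (l.length - i + j) = j + l.length by omega, Nat.add_mod_right,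
    Nat.mod_eq_of_lt hj]

theorem cycOrd_formPerm {l : List α} (hl : l.Nodup) {i j k : ℕ} (hij : i < j) (hjk : j < k)
    (hk : k < l.length) : CycOrd l.formPerm l.toFinset l[i] l[j] l[k] :=
  ⟨j - i, k - i, by omega, by omega, by rw [List.toFinset_card_of_nodup hl]; omega,
    formPerm_iterate hl hij.le _, formPerm_iterate hl (hij.trans hjk).le hk⟩

variable [Fintype α]

theorem exists_orient_eq {O : α → α → α → α → Bool} (hO : IsOrientationOn O Set.univ)
    {L : α → List α} (hL : ∀ v, (L v).Nodup) (hmem : ∀ v x, x ∈ L v ↔ x ≠ v)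
    (h : ∀ v i j k, (hij : i < j) → (hjk : j < k) → (hk : k < (L v).length) →
      O v (L v)[i] (L v)[j] (L v)[k] = true) :
    ∃ P : PreRotSys α, ∀ v b c d, [v, b, c, d].Nodup → P.orient v b c d = O v b c d := by
  have hset (v : α) : (L v).toFinset = Finset.univ.erase v := by
    ext x
    simp [hmem]
  refine ⟨⟨fun v => (L v).formPerm, fun v => hset v ▸ isCyclicPermOn_formPerm (hL v)⟩,
    fun v b c d hn => ?_⟩
  set P : PreRotSys α := ⟨fun v => (L v).formPerm, _⟩
  set w : ℕ → α := fun i => (L v).getD i v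
  have hw (i : ℕ) (hi : i < (L v).length) : w i = (L v)[i] := List.getD_eq_getElem _ _ hi
  have hwv : w (L v).length = v := List.getD_eq_default _ _ le_rfl
  have hinj : Set.InjOn w {i | i ≤ (L v).length} := by
    intro i hi j hj hij
    rcases Nat.lt_or_eq_of_le hi with hi | rfl <;> rcases Nat.lt_or_eq_of_le hj with hj | rfl
    · rw [hw i hi, hw j hj] at hij
      exact ((hL v).getElem_inj_iff).1 hij
    · rw [hw i hi, hwv] at hij
      exact absurd hij ((hmem v _).1 (List.getElem_mem _))
    · rw [hw j hj, hwv] at hij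
      exact absurd hij.symm ((hmem v _).1 (List.getElem_mem _))
    · rfl
  have surj (x : α) (hx : x ≠ v) : ∃ i < (L v).length, w i = x := by
    obtain ⟨i, hi, rfl⟩ := List.getElem_of_mem ((hmem v x).2 hx)
    exact ⟨i, hi, hw i hi⟩
  have hne : b ≠ v ∧ c ≠ v ∧ d ≠ v ∧ b ≠ c ∧ b ≠ d ∧ c ≠ d := by
    simp at hn
    tauto
  obtain ⟨i, hi, rfl⟩ := surj b hne.1
  obtain ⟨j, hj, rfl⟩ := surj c hne.2.1
  obtain ⟨k, hk, rfl⟩ := surj d hne.2.2.1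
  have key := (P.isOrientationOn.comp hinj (Set.mapsTo_univ _ _)).eq_of_increasing
    (hO.comp hinj (Set.mapsTo_univ _ _)) (v := (L v).length) (b := i) (c := j) (d := k)
    (le_refl (L v).length :) ?_ hi.le hj.le hk.le ?_
  · simpa [hwv] using key
  · intro b hb c hc d hd hn' hbc hcd
    have hd : d < (L v).length := lt_of_le_of_ne hd (by simp at hn'; tauto)
    rw [hwv, hw b (by omega), hw c (by omega), hw d hd, h v b c d hbc hcd hd,
      P.orient_eq_true, rotOrd, ← hset]
    exact cycOrd_formPerm (hL v) hbc hcd hd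
  · have : i ≠ j ∧ i ≠ k ∧ j ≠ k :=
      ⟨by rintro rfl; tauto, by rintro rfl; tauto, by rintro rfl; tauto⟩
    simp
    omega

end

/-- The cyclic order around `v` in the system with code `R`. -/
def rotList (R : ℕ) (v : Fin 8) : List (Fin 8) :=
  match (List.finRange 8).erase v with
  | [] => []
  | b :: l => b :: l.insertionSort fun c d => decode R v b c d = true

theorem rotList_perm (R : ℕ) (v : Fin 8) : (rotList R v).Perm ((List.finRange 8).erase v) := by
  unfold rotList
  split
  next h => rw [h]
  next h => rw [h]; exact (List.perm_insertionSort _ _).cons _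

theorem decode_rotList : ∀ R ∈ reps8, ∀ v : Fin 8, ∀ k < 7, ∀ j < k, ∀ i < j,
    decode R v ((rotList R v).getD i 0) ((rotList R v).getD j 0) ((rotList R v).getD k 0) =
      true := by
  decide +kernel

theorem exists_orient_eq_decode {R : ℕ} (hR : R ∈ reps8) :
    ∃ P : PreRotSys (Fin 8), ∀ v b c d : Fin 8, [v, b, c, d].Nodup →
      P.orient v b c d = decode R v b c d := by
  have hnd : ((List.finRange 8)).Nodup := List.nodup_finRange 8
  refine exists_orient_eq (O := fun v b c d : Fin 8 => decode R v b c d)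
    ((isOrientationOn_decode R Set.univ).comp Fin.val_injective.injOn (Set.mapsTo_univ _ _))
    (L := rotList R) (fun v => (rotList_perm R v).nodup_iff.2 (hnd.erase v)) (fun v x => ?_)
    fun v i j k hij hjk hk => ?_
  · rw [(rotList_perm R v).mem_iff, hnd.mem_erase_iff]
    simp
  · have hlen : (rotList R v).length = 7 := by
      rw [(rotList_perm R v).length_eq, List.length_erase_of_mem (by simp)]
      simp
    have := decode_rotList R hR v k (by omega) j hjk i hij
    rw [List.getD_eq_getElem _ _ (by omega), List.getD_eq_getElem _ _ (by omega),
      List.getD_eq_getElem _ _ hk] at this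
    exact this

/-! ### Isomorphisms in terms of orientations -/

section

variable {α : Type*} [Fintype α] [DecidableEq α]

theorem IsCyclicPermOn.conj {f : Equiv.Perm α} {v : α}
    (hf : IsCyclicPermOn f (Finset.univ.erase v)) (e : Equiv.Perm α) :
    IsCyclicPermOn (e * f * e⁻¹) (Finset.univ.erase (e v)) := by
  have mem {a : α} : e a ∈ Finset.univ.erase (e v) ↔ a ∈ Finset.univ.erase v := by simp
  refine ⟨fun a ha => ?_, fun a ha b hb => ?_⟩
  · obtain ⟨a, rfl⟩ := e.surjective a
    simp [hf.1 a (mem.not.1 ha)]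
  · obtain ⟨a, rfl⟩ := e.surjective a
    obtain ⟨b, rfl⟩ := e.surjective b
    obtain ⟨k, hk⟩ := hf.2 a (mem.1 ha) b (mem.1 hb)
    refine ⟨k, ?_⟩
    rw [← hk]
    exact (Function.Semiconj.iterate_right (f := e) (fun x => by simp) k a).symm

theorem isoPRS_of_orient_eq {P P' : PreRotSys α} (hα : 3 < Fintype.card α) {e : Equiv.Perm α}
    {f : Bool} (h : ∀ v b c d, [v, b, c, d].Nodup →
      P.orient v b c d = (P'.orient (e v) (e b) (e c) (e d) ^^ f)) : IsoPRS P P' := by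
  have hcard (v : α) : 2 < (Finset.univ.erase v).card := by
    rw [Finset.card_erase_of_mem (Finset.mem_univ v), Finset.card_univ]
    omega
  have hcard_eq (v : α) : (Finset.univ.erase v).card = (Finset.univ.erase (e v)).card := by
    simp
  cases f
  · refine ⟨e, Or.inl fun v =>
      (P'.cyc (e v)).eq_of_cycOrd ((P.cyc v).conj e) (hcard _)
        fun b hb c hc d hd hbc hbd hcd hO => ?_⟩
    obtain ⟨b, rfl⟩ := e.surjective b
    obtain ⟨c, rfl⟩ := e.surjective c
    obtain ⟨d, rfl⟩ := e.surjective d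
    have hn : [v, b, c, d].Nodup := by simp at *; tauto
    refine CycOrd.conj (hcard_eq v) e (P.orient_eq_true.1 ?_)
    rw [h v b c d hn, P'.orient_eq_true.2 hO, Bool.xor_false]
  · refine ⟨e, Or.inr fun v =>
      (P'.cyc (e v)).eq_of_cycOrd ((P.cyc v).conj e).inv (hcard _)
        fun b hb c hc d hd hbc hbd hcd hO => ?_⟩
    refine CycOrd.inv ((P.cyc v).conj e) hb ?_
    obtain ⟨b, rfl⟩ := e.surjective b
    obtain ⟨c, rfl⟩ := e.surjective c
    obtain ⟨d, rfl⟩ := e.surjective d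
    have hn : [v, b, c, d].Nodup := by simp at *; tauto
    refine CycOrd.conj (hcard_eq v) e (P.orient_eq_true.1 ?_)
    rw [P.orient_swap hn, h v b c d hn, P'.orient_eq_true.2 hO]
    rfl

theorem IsoPRS.exists_orient_eq {P P' : PreRotSys α} (h : IsoPRS P P') :
    ∃ (e : Equiv.Perm α) (f : Bool), ∀ v b c d, [v, b, c, d].Nodup →
      P'.orient (e v) (e b) (e c) (e d) = (P.orient v b c d ^^ f) := by
  obtain ⟨e, h⟩ := h
  have hcard_eq (v : α) : (Finset.univ.erase v).card = (Finset.univ.erase (e v)).card := by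
    simp
  have of_imp (f : Bool) (hf : ∀ v b c d, [v, b, c, d].Nodup → P.orient v b c d = true →
      P'.orient (e v) (e b) (e c) (e d) = !f) (v b c d : α) (hn : [v, b, c, d].Nodup) :
      P'.orient (e v) (e b) (e c) (e d) = (P.orient v b c d ^^ f) := by
    cases hO : P.orient v b c d
    · have := hf v b d c (by grind) (by rw [P.orient_swap hn, hO]; rfl)
      rw [P'.orient_swap (List.Nodup.map (l := [v, b, c, d]) e.injective hn)] at this
      simpa using this
    · rw [hf v b c d hn hO, Bool.true_xor]
  rcases h with h | h
  · refine ⟨e, false, of_imp false fun v b c d hn hO => ?_⟩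
    rw [P'.orient_eq_true.2, Bool.not_false]
    rw [rotOrd, h]
    exact CycOrd.conj (hcard_eq v) e (P.orient_eq_true.1 hO)
  · refine ⟨e, true, of_imp true fun v b c d hn hO => ?_⟩
    have hO' : P'.orient (e v) (e b) (e d) (e c) = true := by
      rw [P'.orient_eq_true, rotOrd, h]
      exact (CycOrd.conj (hcard_eq v) e (P.orient_eq_true.1 hO)).inv ((P.cyc v).conj e)
        (by simp at hn ⊢; tauto)
    rw [P'.orient_swap (List.Nodup.map (l := [v, b, c, d]) e.injective hn)] at hO'
    simpa using hO'

/-! ### An isomorphism invariant -/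

/-- Twice the number of edges that cross the edge `{p, r}`. -/
def crossingCount (O : α → α → α → α → Bool) (p r : α) : ℕ :=
  ∑ q, ∑ s, (decide [p, q, r, s].Nodup && crossing O p q r s).toNat

def crossingInvariant (O : α → α → α → α → Bool) : ℕ :=
  ∑ p, (∑ r, crossingCount O p r ^ 2) ^ 3

theorem crossing_eq {ι : Type*} {O : ι → ι → ι → ι → Bool} (hO : IsOrientationOn O Set.univ)
    {p q r s : ι} (hn : [p, q, r, s].Nodup) : crossing O p q r s =
      (((O p q r s == O q p r s) && (O q p r s == O r p q s)) && (O r p q s == O s p q r)) := by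
  rw [crossing, hO.swap p trivial q trivial r trivial s trivial (by grind),
    hO.swap q trivial p trivial r trivial s trivial (by grind),
    hO.swap r trivial p trivial q trivial s trivial (by grind),
    hO.swap s trivial p trivial q trivial r trivial (by grind)]
  generalize O p q r s = x, O q p r s = y, O r p q s = z, O s p q r = t
  revert x y z t
  decide

theorem crossing_comm {ι : Type*} {O : ι → ι → ι → ι → Bool} (hO : IsOrientationOn O Set.univ)
    {p q r s : ι} (hn : [p, q, r, s].Nodup) : crossing O p s r q = crossing O p q r s := by
  have rotate {v b c d : ι} (hn : [v, b, c, d].Nodup) :=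
    hO.rotate v trivial b trivial c trivial d trivial hn
  have swap {v b c d : ι} (hn : [v, b, c, d].Nodup) :=
    hO.swap v trivial b trivial c trivial d trivial hn
  rw [crossing_eq hO hn, crossing_eq hO (by grind), swap (v := p) (b := s) (c := q) (d := r)
    (by grind), rotate (v := p) (b := r) (c := s) (d := q) (by grind), rotate hn,
    swap (v := s) (b := p) (c := q) (d := r) (by grind), swap (v := r) (b := p) (c := q) (d := s)
    (by grind), swap (v := q) (b := p) (c := r) (d := s) (by grind)]
  generalize O p q r s = x, O q p r s = y, O r p q s = z, O s p q r = t
  revert x y z t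
  decide

theorem crossingInvariant_eq {O O' : α → α → α → α → Bool} (hO : IsOrientationOn O Set.univ)
    (hO' : IsOrientationOn O' Set.univ) {e : Equiv.Perm α} {f : Bool}
    (h : ∀ v b c d, [v, b, c, d].Nodup → O' (e v) (e b) (e c) (e d) = (O v b c d ^^ f)) :
    crossingInvariant O' = crossingInvariant O := by
  have hcross (p q r s : α) :
      (decide [e p, e q, e r, e s].Nodup && crossing O' (e p) (e q) (e r) (e s)) =
      (decide [p, q, r, s].Nodup && crossing O p q r s) := by
    have hiff : [e p, e q, e r, e s].Nodup ↔ [p, q, r, s].Nodup :=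
      List.nodup_map_iff (l := [p, q, r, s]) e.injective
    by_cases hn : [p, q, r, s].Nodup
    · rw [crossing_eq hO hn, crossing_eq hO' (hiff.2 hn), h p q r s hn, h q p r s (by grind),
        h r p q s (by grind), h s p q r (by grind)]
      rw [decide_eq_decide.2 hiff]
      generalize O p q r s = x, O q p r s = y, O r p q s = z, O s p q r = t
      congr 1
      clear h
      revert f x y z t
      decide
    · simp [hiff, hn]
  have hcount (p r : α) : crossingCount O' (e p) (e r) = crossingCount O p r := by
    rw [crossingCount, crossingCount, ← Equiv.sum_comp e]
    refine Finset.sum_congr rfl fun q _ => ?_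
    rw [← Equiv.sum_comp e]
    exact Finset.sum_congr rfl fun s _ => by rw [hcross]
  rw [crossingInvariant, crossingInvariant, ← Equiv.sum_comp e]
  refine Finset.sum_congr rfl fun p _ => ?_
  rw [← Equiv.sum_comp e]
  simp only [hcount]

end

theorem sum_sum_eq_of_symm {n : ℕ} {g : Fin n → Fin n → ℕ} (hg : ∀ q s, g q s = g s q)
    (hg₀ : ∀ q, g q q = 0) : ∑ q, ∑ s, g q s = 2 * ∑ q, ∑ s, if s < q then g q s else 0 := by
  have split (q s : Fin n) : g q s = (if s < q then g q s else 0) + if q < s then g s q else 0 := by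
    rcases lt_trichotomy q s with h | rfl | h
    · simp [h, h.not_gt, hg q s]
    · simp [hg₀]
    · simp [h, h.not_gt]
  rw [Finset.sum_congr rfl fun q _ => Finset.sum_congr rfl fun s _ => split q s]
  simp only [Finset.sum_add_distrib]
  rw [Finset.sum_comm (f := fun q s => if q < s then g s q else 0), two_mul]

/-- The test for edges of a twisted system to cross, in a form that is fast to evaluate. -/
def codeCrosses (R : ℕ) (p q r s : Fin 8) : Bool :=
  (s.val.blt q.val && (!p.val.beq q && !q.val.beq r && !r.val.beq s && !p.val.beq s)) &&
    ((decode R p q r s == decode R q p r s) && (decode R q p r s == decode R r p q s))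

def codeInvariant (R : ℕ) : ℕ :=
  ((List.finRange 8).map fun p => (((List.finRange 8).map fun r => bif p.val.beq r then 0 else
    (2 * ((List.finRange 8).map fun q =>
      ((List.finRange 8).map fun s => (codeCrosses R p q r s).toNat).sum).sum) ^ 2).sum) ^ 3).sum

theorem crossingInvariant_decode {R : ℕ} (hR : R ∈ reps8) :
    crossingInvariant (fun v b c d : Fin 8 => decode R v b c d) = codeInvariant R := by
  have hO : IsOrientationOn (fun v b c d : Fin 8 => decode R v b c d) Set.univ :=
    (isOrientationOn_decode R Set.univ).comp Fin.val_injective.injOn (Set.mapsTo_univ _ _)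
  have hcross (p q r s : Fin 8) (hpr : p ≠ r) :
      (if s < q then (decide [p, q, r, s].Nodup &&
        crossing (fun v b c d : Fin 8 => decode R v b c d) p q r s).toNat else 0) =
      (codeCrosses R p q r s).toNat := by
    have hguard : (s.val.blt q.val && (!p.val.beq q && !q.val.beq r && !r.val.beq s &&
        !p.val.beq s)) = decide (s < q ∧ p ≠ q ∧ q ≠ r ∧ r ≠ s ∧ p ≠ s) := by
      rw [Bool.eq_iff_iff]
      simp only [Bool.and_eq_true, Bool.not_eq_true', ← Bool.not_eq_true, Nat.blt_eq, Nat.beq_eq,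
        decide_eq_true_eq, ne_eq, Fin.ext_iff, Fin.lt_def]
      tauto
    rw [codeCrosses, hguard]
    by_cases hsq : s < q
    · by_cases hn : [p, q, r, s].Nodup
      · have key := (isTwistedSystem_decode hR).forall_of_forall
          (Q := fun x _ _ y z t => ((x == y) && (y == z) && (z == t)) = ((x == y) && (y == z)))
          (by decide +kernel) p.2 q.2 r.2 s.2 (List.Nodup.map (l := [p, q, r, s])
            Fin.val_injective hn)
        have hne : p ≠ q ∧ q ≠ r ∧ r ≠ s ∧ p ≠ s := by simp at hn; tauto
        rw [crossing_eq hO hn, key]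
        simp [hsq, hn, hne]
      · have hne : ¬ (p ≠ q ∧ q ≠ r ∧ r ≠ s ∧ p ≠ s) := by
          simp at hn ⊢
          have := hsq.ne'
          tauto
        simp only [hsq, hn, hne, true_and, decide_false, Bool.false_and, ite_true]
    · simp [hsq]
  have hcount (p r : Fin 8) : crossingCount (fun v b c d : Fin 8 => decode R v b c d) p r ^ 2 =
      bif p.val.beq r then 0 else (2 * ((List.finRange 8).map fun q =>
        ((List.finRange 8).map fun s => (codeCrosses R p q r s).toNat).sum).sum) ^ 2 := by
    by_cases hpr : p = r
    · subst hpr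
      simp [crossingCount]
    · have : p.val.beq r = false := by
        rw [← Bool.not_eq_true, Nat.beq_eq]
        exact fun h => hpr (Fin.ext h)
      rw [crossingCount, sum_sum_eq_of_symm]
      · simp only [hcross p _ r _ hpr, this, cond_false, Fin.sum_univ_def]
      · intro q s
        by_cases hn : [p, q, r, s].Nodup
        · have hn' : [p, s, r, q].Nodup := by grind
          rw [crossing_comm hO hn]
          simp only [hn, hn']
        · have hn' : ¬ [p, s, r, q].Nodup := by grind
          simp only [hn, hn', decide_false, Bool.false_and]
      · intro q
        simp
  simp only [crossingInvariant, codeInvariant, hcount, Fin.sum_univ_def]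

theorem map_codeInvariant_reps8 : reps8.map codeInvariant =
    [10537203200, 9837536768, 10076833280, 9967568384, 10206533120, 10181158400, 10075383296,
      9967666688, 9799419392, 10238039552, 9982019072, 10027619840, 9641629184, 9725789696,
      9835650560, 10375554560, 9471440384, 9751311872, 9873700352, 10197501440, 10217844224,
      10015393280, 10080267776, 9972772352, 10544403968, 10221573632, 10735961600, 9958721024,
      9466193408, 9531614720, 9373173248, 9211930112] := by
  decide +kernel

theorem genTwisted_of_orient_eq_decode {R : ℕ} (hR : R ∈ reps8) {P : PreRotSys (Fin 8)}
    (hP : ∀ v b c d : Fin 8, [v, b, c, d].Nodup → P.orient v b c d = decode R v b c d) :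
    GenTwisted P := by
  refine genTwisted_of_isTwistedOn (by simp) fun w hw => ?_
  obtain ⟨p, f, h⟩ := isTwistedSystem_decode hR (fun i => (w i : ℕ))
    (Fin.val_injective.comp hw.injective) fun i => (w i).2
  refine ⟨p, f, fun i j k l hn => ?_⟩
  rw [hP _ _ _ _ (List.Nodup.map (l := [i, j, k, l]) hw.injective hn), h i j k l hn]

theorem crossingInvariant_eq_of_isoPRS {α : Type*} [Fintype α] [DecidableEq α]
    {P P' : PreRotSys α} (h : IsoPRS P P') :
    crossingInvariant P.orient = crossingInvariant P'.orient := by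
  obtain ⟨e, f, hf⟩ := h.exists_orient_eq
  exact (crossingInvariant_eq P.isOrientationOn P'.isOrientationOn hf).symm

theorem crossingInvariant_of_orient_eq_decode {R : ℕ} (hR : R ∈ reps8) {P : PreRotSys (Fin 8)}
    (hP : ∀ v b c d : Fin 8, [v, b, c, d].Nodup → P.orient v b c d = decode R v b c d) :
    crossingInvariant P.orient = codeInvariant R := by
  rw [← crossingInvariant_decode hR]
  exact crossingInvariant_eq ((isOrientationOn_decode R Set.univ).comp Fin.val_injective.injOn
    (Set.mapsTo_univ _ _)) P.isOrientationOn (e := Equiv.refl _) (f := false) fun v b c d hn => by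
      simp [hP v b c d hn]

/-- Up to isomorphism (relabelling, possibly followed by reflection),
there are exactly 32 generalized twisted pre-rotation systems on an 8-element set. -/
theorem gen_twisted_on_eight_elements_up_to_iso :
    Nat.card (Quot (fun P P' : {Q : PreRotSys (Fin 8) // GenTwisted Q} =>
      IsoPRS P.1 P'.1)) = 32 := by
  choose sys hsys using fun i : Fin reps8.length => exists_orient_eq_decode (reps8.get_mem i)
  rw [← show reps8.length = 32 from rfl, ← Nat.card_fin reps8.length]
  refine (Nat.card_eq_of_bijective (fun i : Fin reps8.length =>
    Quot.mk _ ⟨sys i, genTwisted_of_orient_eq_decode (reps8.get_mem i) (hsys i)⟩)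
      ⟨fun i j hij => ?_, fun x => ?_⟩).symm
  · have hinv := congrArg (Quot.lift
      (fun Q : {Q : PreRotSys (Fin 8) // GenTwisted Q} => crossingInvariant Q.1.orient)
      fun _ _ => crossingInvariant_eq_of_isoPRS) hij
    change crossingInvariant (sys i).orient = crossingInvariant (sys j).orient at hinv
    rw [crossingInvariant_of_orient_eq_decode (reps8.get_mem i) (hsys i),
      crossingInvariant_of_orient_eq_decode (reps8.get_mem j) (hsys j)] at hinv
    have hnd : (reps8.map codeInvariant).Nodup := by
      rw [map_codeInvariant_reps8]
      decide
    exact List.nodup_iff_injective_get.1 hnd.of_map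
      (List.inj_on_of_nodup_map hnd (reps8.get_mem i) (reps8.get_mem j) hinv)
  · obtain ⟨⟨P, hP⟩, rfl⟩ := Quot.exists_rep x
    obtain ⟨e, f, R, hR, h⟩ := hP.exists_decode_eq
    obtain ⟨i, hi, rfl⟩ := List.getElem_of_mem hR
    exact ⟨⟨i, hi⟩, Quot.sound (isoPRS_of_orient_eq (by simp) (e := e) (f := f)
      fun v b c d hn => (hsys ⟨i, hi⟩ v b c d hn).trans (h v b c d hn))⟩
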